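/- For every n ≥ 0, the natural surjection A_n(V) → A_{n,n}(V) (induced by the inclusion O_n(V) ⊆ O_{n,n}(V)) is an isomorphism; i.e., O_n(V) = O_{n,n}(V). -/

import Mathlib

/-- Generalized binomial coefficient `C(n, k)` for `n : ℤ`, valued in `ℂ`. -/
noncomputable def cbinom (n : ℤ) (k : ℕ) : ℂ :=
  (∏ i ∈ Finset.range k, ((n : ℂ) - (i : ℂ))) / (Nat.factorial k : ℂ)

/-- A vertex operator algebra structure on a complex vector space `V`. -/
structure VOA (V : Type) [AddCommGroup V] [Module ℂ V] where
  mode : V → ℤ → Module.End ℂ V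
  vacuum : V
  conformal : V
  grading : ℤ → Submodule ℂ V
  internal : Function.Bijective (DirectSum.coeLinearMap grading)
  mode_add : ∀ (u v : V) (n : ℤ), mode (u + v) n = mode u n + mode v n
  mode_smul : ∀ (c : ℂ) (u : V) (n : ℤ), mode (c • u) n = c • mode u n
  truncation : ∀ u v : V, ∃ N : ℤ, ∀ n : ℤ, N ≤ n → mode u n v = 0
  vacuum_mem : vacuum ∈ grading 0
  conformal_mem : conformal ∈ grading 2
  vacuum_mode : ∀ (v : V) (n : ℤ), mode vacuum n v = if n = -1 then v else 0
  creation : ∀ (u : V) (n : ℤ), 0 ≤ n → mode u n vacuum = 0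
  creation_neg_one : ∀ u : V, mode u (-1) vacuum = u
  L0_eigen : ∀ (n : ℤ) (u : V), u ∈ grading n → mode conformal 1 u = (n : ℂ) • u
  Lneg1_deriv : ∀ (u : V) (n : ℤ), mode (mode conformal 0 u) n = (-n : ℂ) • mode u (n - 1)
  grading_mode : ∀ (r s m : ℤ) (u v : V), u ∈ grading r → v ∈ grading s →
    mode u m v ∈ grading (r + s - m - 1)
  bounded_below : ∃ N : ℤ, ∀ n : ℤ, n < N → grading n = ⊥
  fin_dim : ∀ n : ℤ, FiniteDimensional ℂ (grading n)
  borcherds : ∀ (p q r : ℤ) (u v w : V),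
    (∑ᶠ i : ℕ, cbinom p i • mode (mode u (r + i) v) (p + q - i) w) =
    ∑ᶠ i : ℕ, ((-1 : ℂ) ^ i * cbinom r i) •
      (mode u (p + r - i) (mode v (q + i) w)
        - (-1 : ℂ) ^ r • mode v (q + r - i) (mode u (p + i) w))

variable {V : Type} [AddCommGroup V] [Module ℂ V]

/-- Projection onto the weight-`n` subspace. -/
noncomputable def VOA.proj (d : VOA V) (n : ℤ) : V →ₗ[ℂ] V :=
  (d.grading n).subtype ∘ₗ (DirectSum.component ℂ ℤ (fun m => d.grading m) n) ∘ₗ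
    (LinearEquiv.ofBijective (DirectSum.coeLinearMap d.grading) d.internal).symm.toLinearMap

/-- `Res_z (1+z)^N z^{-k} Y(u,z)v` for a vector `u` regarded as having weight contribution `N`. -/
noncomputable def VOA.hres (d : VOA V) (N k : ℤ) (u v : V) : V :=
  ∑ᶠ i : ℕ, cbinom N i • d.mode u ((i : ℤ) - k) v

/-- `Res_z (1+z)^{wt u + m} z^{-k} Y(u,z)v`, extended bilinearly from homogeneous `u`. -/
noncomputable def VOA.bres (d : VOA V) (m k : ℤ) (u v : V) : V :=
  ∑ᶠ n : ℤ, d.hres (n + m) k (d.proj n u) v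

/-- The Zhu product `u * v`. -/
noncomputable def VOA.star (d : VOA V) (u v : V) : V := d.bres 0 1 u v

/-- The Zhu circle product `u ∘ v`. -/
noncomputable def VOA.circ (d : VOA V) (u v : V) : V := d.bres 0 2 u v

/-- The subspace `O(V)` spanned by all `u ∘ v`. -/
def VOA.Ozhu (d : VOA V) : Submodule ℂ V := Submodule.span ℂ {w : V | ∃ u v : V, w = d.circ u v}

/-- The product `u ∘_n v`. -/
noncomputable def VOA.circn (d : VOA V) (n : ℕ) (u v : V) : V := d.bres n (2 * n + 2) u v

/-- The product `u *_n v` of Dong–Li–Mason. -/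
noncomputable def VOA.starn (d : VOA V) (n : ℕ) (u v : V) : V :=
  ∑ m ∈ Finset.range (n + 1),
    ((-1 : ℂ) ^ m * cbinom ((m : ℤ) + (n : ℤ)) n) • d.bres n ((n : ℤ) + (m : ℤ) + 1) u v

/-- The subspace `O_n(V)`. -/
def VOA.On (d : VOA V) (n : ℕ) : Submodule ℂ V :=
  Submodule.span ℂ ({w : V | ∃ u v : V, w = d.circn n u v} ∪
    {w : V | ∃ u : V, w = d.mode d.conformal 0 u + d.mode d.conformal 1 u})

/-- The Dong–Jiang product `u *_{m,p}^n v`. -/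
noncomputable def VOA.starmpn (d : VOA V) (m p n : ℕ) (u v : V) : V :=
  ∑ i ∈ Finset.range (p + 1),
    ((-1 : ℂ) ^ i * cbinom ((m : ℤ) + (n : ℤ) - (p : ℤ) + (i : ℤ)) i) •
      d.bres m ((m : ℤ) + (n : ℤ) - (p : ℤ) + (i : ℤ) + 1) u v

/-- The Dong–Jiang product `u ∘_m^n v`. -/
noncomputable def VOA.circmn (d : VOA V) (n m : ℕ) (u v : V) : V :=
  d.bres m ((n : ℤ) + (m : ℤ) + 2) u v

/-- The subspace `O_{n,m}(V) = O'_{n,m}(V) + O''_{n,m}(V) + O'''_{n,m}(V)` of Dong–Jiang. -/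
def VOA.Onm (d : VOA V) (n m : ℕ) : Submodule ℂ V :=
  Submodule.span ℂ (
    {w : V | ∃ u v : V, w = d.circmn n m u v} ∪
    {w : V | ∃ u : V, w = d.mode d.conformal 0 u + d.mode d.conformal 1 u
        + (((m : ℂ) - (n : ℂ)) • u)} ∪
    {w : V | ∃ (u a b c : V) (p₁ p₂ p₃ : ℕ), w = d.starmpn m p₃ n u
        (d.starmpn m p₁ p₃ (d.starmpn p₁ p₂ p₃ a b) c
          - d.starmpn m p₂ p₃ a (d.starmpn m p₁ p₂ b c))} ∪
    {w : V | ∃ (p : ℕ) (u x v : V), x ∈ d.On p ∧ w = d.starmpn m p n (d.starmpn p p n u x) v})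

/-- The subspace `C_2(V)` spanned by the `u_{-2} v`. -/
def VOA.C2 (d : VOA V) : Submodule ℂ V := Submodule.span ℂ {w : V | ∃ u v : V, w = d.mode u (-2) v}

/-- `V` is a simple vertex operator algebra: its only ideals are `0` and `V`. -/
def VOA.IsSimpleVOA (d : VOA V) : Prop :=
  (∃ v : V, v ≠ 0) ∧ ∀ P : Submodule ℂ V,
    (∀ (u : V) (n : ℤ), ∀ w ∈ P, d.mode u n w ∈ P) → P = ⊥ ∨ P = ⊤

/-- A weak module for the vertex operator algebra `d`. -/
structure WeakMod (d : VOA V) (M : Type) [AddCommGroup M] [Module ℂ M] where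
  act : V → ℤ → Module.End ℂ M
  act_add : ∀ (u v : V) (n : ℤ), act (u + v) n = act u n + act v n
  act_smul : ∀ (c : ℂ) (u : V) (n : ℤ), act (c • u) n = c • act u n
  truncation : ∀ (u : V) (w : M), ∃ N : ℤ, ∀ n : ℤ, N ≤ n → act u n w = 0
  vacuum_act : ∀ (w : M) (n : ℤ), act d.vacuum n w = if n = -1 then w else 0
  borcherds : ∀ (p q r : ℤ) (u v : V) (w : M),
    (∑ᶠ i : ℕ, cbinom p i • act (d.mode u (r + i) v) (p + q - i) w) =
    ∑ᶠ i : ℕ, ((-1 : ℂ) ^ i * cbinom r i) •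
      (act u (p + r - i) (act v (q + i) w)
        - (-1 : ℂ) ^ r • act v (q + r - i) (act u (p + i) w))

/-- An admissible (ℤ₊-graded) module for the vertex operator algebra `d`. -/
structure AdmMod (d : VOA V) (M : Type) [AddCommGroup M] [Module ℂ M]
    extends WeakMod d M where
  gr : ℤ → Submodule ℂ M
  gr_internal : Function.Bijective (DirectSum.coeLinearMap gr)
  gr_neg : ∀ n : ℤ, n < 0 → gr n = ⊥
  gr_act : ∀ (r : ℤ) (u : V), u ∈ d.grading r → ∀ (m n : ℤ) (w : M), w ∈ gr n →
    act u m w ∈ gr (r + n - m - 1)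

variable {M : Type} [AddCommGroup M] [Module ℂ M]

/-- The zero-mode `o(v) = v_{wt v - 1}`, extended linearly from homogeneous `v`. -/
noncomputable def WeakMod.o {d : VOA V} (W : WeakMod d M) (v : V) (w : M) : M :=
  ∑ᶠ r : ℤ, W.act (d.proj r v) (r - 1) w

/-- The mode `o_t(v) = v_{wt v - 1 - t}`, extended linearly from homogeneous `v`. -/
noncomputable def WeakMod.ot {d : VOA V} (W : WeakMod d M) (t : ℤ) (v : V) (w : M) : M :=
  ∑ᶠ r : ℤ, W.act (d.proj r v) (r - 1 - t) w

/-- The subspace `Ω_n(M)` of a weak module. -/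
def WeakMod.OmegaSet {d : VOA V} (W : WeakMod d M) (n : ℕ) : Set M :=
  {w : M | ∀ (r : ℤ) (u : V), u ∈ d.grading r → ∀ m : ℤ, m > r - 1 + (n : ℤ) → W.act u m w = 0}

/-- A subspace stable under all modes. -/
def WeakMod.IsStable {d : VOA V} (W : WeakMod d M) (P : Submodule ℂ M) : Prop :=
  ∀ (u : V) (n : ℤ), ∀ w ∈ P, W.act u n w ∈ P

/-- A subspace compatible with the grading of an admissible module. -/
def AdmMod.IsGraded {d : VOA V} (A : AdmMod d M) (P : Submodule ℂ M) : Prop :=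
  P = ⨆ n : ℤ, (P ⊓ A.gr n)

/-- `P` is an irreducible admissible submodule. -/
def AdmMod.IrredSub {d : VOA V} (A : AdmMod d M) (P : Submodule ℂ M) : Prop :=
  P ≠ ⊥ ∧ A.toWeakMod.IsStable P ∧ A.IsGraded P ∧
    ∀ Q : Submodule ℂ M, Q ≤ P → A.toWeakMod.IsStable Q → A.IsGraded Q → Q = ⊥ ∨ Q = P

/-- The admissible module is irreducible. -/
def AdmMod.IsIrreducible {d : VOA V} (A : AdmMod d M) : Prop :=
  (∃ w : M, w ≠ 0) ∧
    ∀ P : Submodule ℂ M, A.toWeakMod.IsStable P → A.IsGraded P → P = ⊥ ∨ P = ⊤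

/-- Rationality: every admissible module is a direct sum of irreducible admissible submodules. -/
def Rational (d : VOA V) : Prop :=
  ∀ (M : Type) [AddCommGroup M] [Module ℂ M] (A : AdmMod d M),
    ∃ (ι : Type) (f : ι → Submodule ℂ M),
      (∀ i, A.IrredSub (f i)) ∧ iSupIndep f ∧ (⨆ i, f i) = ⊤

/-- Equivalence of admissible modules. -/
def AdmEquiv {d : VOA V} {M₁ M₂ : Type} [AddCommGroup M₁] [Module ℂ M₁]
    [AddCommGroup M₂] [Module ℂ M₂] (A₁ : AdmMod d M₁) (A₂ : AdmMod d M₂) : Prop :=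
  ∃ e : M₁ ≃ₗ[ℂ] M₂, ∀ (u : V) (n : ℤ) (w : M₁), e (A₁.act u n w) = A₂.act u n (e w)

/-- An ordinary-module structure on a weak module: a `ℂ`-grading by finite dimensional
`L(0)`-eigenspaces, bounded below in each coset of `ℤ`. -/
structure OrdinaryStruct {d : VOA V} (W : WeakMod d M) where
  grc : ℂ → Submodule ℂ M
  internal : Function.Bijective (DirectSum.coeLinearMap grc)
  eigen : ∀ (lam : ℂ) (w : M), w ∈ grc lam → W.act d.conformal 1 w = lam • w
  findim : ∀ lam : ℂ, FiniteDimensional ℂ (grc lam)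
  bounded : ∀ lam : ℂ, ∃ N : ℤ, ∀ n : ℤ, n < N → grc (lam + (n : ℂ)) = ⊥

/-- An admissible module is ordinary. -/
def AdmMod.IsOrdinary {d : VOA V} (A : AdmMod d M) : Prop :=
  Nonempty (OrdinaryStruct A.toWeakMod)

/-- A realization of the quotient associative algebra `V/Osub` with product induced by `mu`. -/
structure Realization (Osub : Submodule ℂ V) (mu : V → V → V) (one : V) where
  carrier : Type
  [ring : Ring carrier]
  [alg : Algebra ℂ carrier]
  emb : V →ₗ[ℂ] carrier
  surj : Function.Surjective emb
  ker_eq : LinearMap.ker emb = Osub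
  mul_compat : ∀ u v : V, emb (mu u v) = emb u * emb v
  one_compat : emb one = 1

/-- The realized algebra is semisimple. -/
def Realization.Semisimple {Osub : Submodule ℂ V} {mu : V → V → V} {one : V}
    (R : Realization Osub mu one) : Prop :=
  letI := R.ring; IsSemisimpleRing R.carrier

/-- The realized algebra is finite dimensional over `ℂ`. -/
def Realization.FinDim {Osub : Submodule ℂ V} {mu : V → V → V} {one : V}
    (R : Realization Osub mu one) : Prop :=
  letI := R.ring; letI := R.alg; FiniteDimensional ℂ R.carrier

/-- A module over the quotient algebra `V/Osub`, given as a representation of `V`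
killing `Osub` and multiplicative for `mu`. -/
structure RepOf (Osub : Submodule ℂ V) (mu : V → V → V) (one : V)
    (U : Type) [AddCommGroup U] [Module ℂ U] where
  rep : V →ₗ[ℂ] Module.End ℂ U
  kills : ∀ v ∈ Osub, rep v = 0
  mul_compat : ∀ u v : V, rep (mu u v) = rep u * rep v
  one_compat : rep one = 1

/-- Simplicity of such a representation. -/
def RepOf.IsSimple {Osub : Submodule ℂ V} {mu : V → V → V} {one : V}
    {U : Type} [AddCommGroup U] [Module ℂ U] (Z : RepOf Osub mu one U) : Prop :=
  (∃ u : U, u ≠ 0) ∧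
    ∀ P : Submodule ℂ U, (∀ v : V, ∀ x ∈ P, Z.rep v x ∈ P) → P = ⊥ ∨ P = ⊤

/-- Equivalence of two such representations. -/
def RepEquiv {Osub : Submodule ℂ V} {mu : V → V → V} {one : V}
    {U₁ U₂ : Type} [AddCommGroup U₁] [Module ℂ U₁] [AddCommGroup U₂] [Module ℂ U₂]
    (Z₁ : RepOf Osub mu one U₁) (Z₂ : RepOf Osub mu one U₂) : Prop :=
  ∃ e : U₁ ≃ₗ[ℂ] U₂, ∀ (v : V) (x : U₁), e (Z₁.rep v x) = Z₂.rep v (e x)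

namespace ResCalc

instance : SMulCommClass ℂ (LaurentSeries ℂ) (LaurentSeries ℂ) where
  smul_comm c F G := by
    simp only [smul_eq_mul, ← HahnSeries.C_mul_eq_smul]; ring

instance : IsScalarTower ℂ (LaurentSeries ℂ) (LaurentSeries ℂ) where
  smul_assoc c F G := by
    simp only [smul_eq_mul, ← HahnSeries.C_mul_eq_smul]; ring

/-- The local coordinate `z = x - 1` as a formal Laurent series. -/
noncomputable def Z : LaurentSeries ℂ := HahnSeries.single 1 1

/-- The global coordinate `x = 1 + z`. -/
noncomputable def X : LaurentSeries ℂ := 1 + Z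

theorem Z_zpow (k : ℤ) : Z ^ k = HahnSeries.single k (1 : ℂ) := by
  simpa [Z] using (RatFunc.single_zpow (F := ℂ) k).symm

theorem Z_ne_zero : Z ≠ 0 := by simp [Z]

theorem coeff_mul_Z_zpow (F : LaurentSeries ℂ) (k i : ℤ) :
    (F * Z ^ k).coeff i = F.coeff (i - k) := by
  rw [Z_zpow, HahnSeries.coeff_mul_single, mul_one]

theorem coeff_Z_zpow (k i : ℤ) : (Z ^ k).coeff i = if i = k then 1 else 0 := by
  rw [Z_zpow, HahnSeries.coeff_single]; congr

theorem coeff_X_mul (F : LaurentSeries ℂ) (i : ℤ) :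
    (X * F).coeff i = F.coeff i + F.coeff (i - 1) := by
  have := coeff_mul_Z_zpow F 1 i
  rw [zpow_one, mul_comm] at this
  rw [X, add_mul, one_mul, HahnSeries.coeff_add, this]

theorem X_ne_zero : X ≠ 0 := by
  intro h
  have := congrArg (fun F : LaurentSeries ℂ => F.coeff 0) h
  simp [X, Z] at this

theorem cbinom_zero_right (n : ℤ) : cbinom n 0 = 1 := by simp [cbinom]

theorem cbinom_succ_right (n : ℤ) (k : ℕ) :
    cbinom n (k + 1) = cbinom n k * ((n - k) / (k + 1)) := by
  have : (k.factorial : ℂ) ≠ 0 := by exact_mod_cast k.factorial_ne_zero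
  have h2 : (k : ℂ) + 1 ≠ 0 := by exact_mod_cast k.succ_ne_zero
  rw [cbinom, cbinom, Finset.prod_range_succ, Nat.factorial_succ]
  push_cast
  field_simp

theorem cbinom_succ_succ (n : ℤ) (k : ℕ) :
    cbinom (n + 1) (k + 1) = cbinom n (k + 1) + cbinom n k := by
  induction k with
  | zero => simp [cbinom]
  | succ k ih =>
    have h2 : (k : ℂ) + 1 ≠ 0 := by exact_mod_cast k.succ_ne_zero
    have h3 : (k : ℂ) + 1 + 1 ≠ 0 := by exact_mod_cast (k + 1).succ_ne_zero
    rw [cbinom_succ_right (n + 1), ih, cbinom_succ_right n (k + 1), cbinom_succ_right n k]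
    push_cast
    field_simp
    ring

theorem cbinom_zero_succ (k : ℕ) : cbinom 0 (k + 1) = 0 := by
  rw [cbinom, Finset.prod_eq_zero (Finset.mem_range.2 k.succ_pos) (by simp), zero_div]

theorem cbinom_neg (N : ℤ) (i : ℕ) :
    cbinom (-N - 1) i = (-1) ^ i * cbinom (N + i) i := by
  have h (i : ℕ) : cbinom (N + i) i = (∏ j ∈ Finset.range i, ((N : ℂ) + 1 + j)) / i.factorial := by
    rw [cbinom, ← Finset.prod_range_reflect]
    congr 1
    refine Finset.prod_congr rfl fun j hj => ?_
    have : j + 1 ≤ i := Finset.mem_range.1 hj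
    rw [show i - 1 - j = i - (j + 1) by omega, Nat.cast_sub this]
    push_cast; ring
  rw [h, cbinom, mul_div_assoc', ← Finset.card_range i, ← Finset.prod_const, Finset.card_range,
    ← Finset.prod_mul_distrib]
  congr 1
  refine Finset.prod_congr rfl fun j _ => ?_
  push_cast; ring

theorem cbinom_eq_choose (n : ℤ) (k : ℕ) : cbinom n k = (Ring.choose n k : ℤ) := by
  have h := congrArg (Int.cast : ℤ → ℂ) (Ring.descPochhammer_eq_factorial_smul_choose n k)
  have hk : (k.factorial : ℂ) ≠ 0 := by exact_mod_cast k.factorial_ne_zero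
  have h2 : ((Polynomial.smeval (descPochhammer ℤ k) n : ℤ) : ℂ)
      = ∏ i ∈ Finset.range k, ((n : ℂ) - (i : ℂ)) := by
    rw [← Polynomial.eval_eq_smeval, descPochhammer_eval_eq_prod_range]
    push_cast; rfl
  rw [cbinom, ← h2, h]
  push_cast [nsmul_eq_mul]
  field_simp

noncomputable def binomSeries (N : ℤ) : LaurentSeries ℂ :=
  HahnSeries.ofPowerSeries ℤ ℂ (PowerSeries.mk (cbinom N))

theorem binomSeries_succ (N : ℤ) : binomSeries (N + 1) = binomSeries N * X := by
  have h : PowerSeries.mk (cbinom (N + 1)) =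
      PowerSeries.mk (cbinom N) * (1 + PowerSeries.X) := by
    ext k
    rw [mul_add, mul_one]
    cases k with
    | zero => simp [cbinom_zero_right]
    | succ k => simp [cbinom_succ_succ, PowerSeries.coeff_succ_mul_X]
  rw [binomSeries, h, map_mul, map_add, map_one, HahnSeries.ofPowerSeries_X]
  rfl

theorem X_zpow_eq (N : ℤ) : X ^ N = binomSeries N := by
  have h0 : binomSeries 0 = 1 := by
    have : PowerSeries.mk (cbinom 0) = 1 := by
      ext k
      cases k with
      | zero => simp [cbinom_zero_right]
      | succ k => simp [cbinom_zero_succ, PowerSeries.coeff_one]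
    rw [binomSeries, this, map_one]
  induction N using Int.induction_on with
  | zero => simp [h0]
  | succ k ih => rw [zpow_add_one₀ X_ne_zero, ih, binomSeries_succ]
  | pred k ih =>
    rw [zpow_sub_one₀ X_ne_zero, ih, mul_inv_eq_iff_eq_mul₀ X_ne_zero, ← binomSeries_succ]
    simp

theorem coeff_X_zpow_natCast (N : ℤ) (k : ℕ) : (X ^ N).coeff k = cbinom N k := by
  rw [X_zpow_eq, binomSeries, HahnSeries.ofPowerSeries_apply_coeff, PowerSeries.coeff_mk]

theorem coeff_X_zpow_of_neg (N i : ℤ) (hi : i < 0) : (X ^ N).coeff i = 0 := by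
  rw [X_zpow_eq, binomSeries, HahnSeries.ofPowerSeries_apply]
  refine HahnSeries.embDomain_of_notMem_range ?_
  rintro ⟨n, hn⟩
  simp at hn
  omega

/-- Laurent expansions at `x = 1` of combinations of `x ^ s * (x - 1) ^ t` vanishing to order at
least `α` at `x = 0` and to order at least `β` at `x = ∞`. -/
def S (α β : ℤ) : Submodule ℂ (LaurentSeries ℂ) where
  carrier := {F | ∀ i : ℤ, -(α + β) < i → (X ^ (-α) * F).coeff i = 0}
  add_mem' {F G} hF hG i hi := by
    rw [mul_add, HahnSeries.coeff_add, hF i hi, hG i hi, add_zero]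
  zero_mem' i _ := by simp
  smul_mem' c F hF i hi := by
    rw [mul_smul_comm, HahnSeries.coeff_smul, hF i hi, smul_zero]

theorem monomial_mem_S (s t : ℤ) {α β : ℤ} (h : s = α) (h' : α + β ≤ -t) :
    X ^ s * Z ^ t ∈ S α β := by
  subst h
  intro i hi
  rw [← mul_assoc, ← zpow_add₀ X_ne_zero, neg_add_cancel, zpow_zero, one_mul, coeff_Z_zpow, if_neg]
  omega

theorem mul_mem_S {α β α' β' γ δ : ℤ} {F G : LaurentSeries ℂ} (hF : F ∈ S α β) (hG : G ∈ S α' β')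
    (h : γ = α + α') (h' : δ ≤ β + β') : F * G ∈ S γ δ := by
  subst h
  intro i hi
  rw [neg_add, zpow_add₀ X_ne_zero, mul_mul_mul_comm, HahnSeries.coeff_mul]
  refine Finset.sum_eq_zero fun p hp => ?_
  have hp := (Finset.mem_antidiagonal.1 hp).2.2
  rcases lt_or_ge (-(α + β)) p.1 with h1 | h1
  · rw [hF _ h1, zero_mul]
  · rw [hG _ (by omega), mul_zero]

theorem S_mono_left_one {α β : ℤ} {F : LaurentSeries ℂ} (hF : F ∈ S α β) : F ∈ S (α - 1) β := by
  intro i hi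
  rw [show -(α - 1) = 1 + -α by ring, zpow_add₀ X_ne_zero, zpow_one, mul_assoc, coeff_X_mul,
    hF i (by omega), hF (i - 1) (by omega), add_zero]

theorem S_mono {α β α' β' : ℤ} {F : LaurentSeries ℂ} (hF : F ∈ S α β) (h : α' ≤ α) (h' : β' ≤ β) :
    F ∈ S α' β' := by
  have h1 (k : ℕ) : F ∈ S (α - k) β := by
    induction k with
    | zero => simpa using hF
    | succ k ih =>
      have := S_mono_left_one ih
      rwa [show α - (k + 1 : ℕ) = α - k - 1 by push_cast; ring]
  have h2 := h1 (α - α').toNat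
  rw [show α - ((α - α').toNat : ℤ) = α' by omega] at h2
  exact fun i hi => h2 i (by omega)

theorem S_inter_one {α β β' : ℤ} {F : LaurentSeries ℂ} (h : F ∈ S α β) (h' : F ∈ S (α + 1) β') :
    F ∈ S (α + 1) β := by
  have key (i : ℤ) (hi : -(α + β) < i) :
      (X ^ (-(α + 1)) * F).coeff i + (X ^ (-(α + 1)) * F).coeff (i - 1) = 0 := by
    rw [← coeff_X_mul, ← mul_assoc, ← zpow_one_add₀ X_ne_zero,
      show 1 + -(α + 1) = -α by ring, h i hi]
  have down (k : ℕ) : ∀ i : ℤ, -(α + 1 + β) < i → -(α + 1 + β') < i + k →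
      (X ^ (-(α + 1)) * F).coeff i = 0 := by
    induction k with
    | zero => intro i _ hi; exact h' i (by simpa using hi)
    | succ k ih =>
      intro i hi hk
      have := key (i + 1) (by omega)
      rwa [ih (i + 1) (by omega) (by push_cast at hk; omega), zero_add, add_sub_cancel_right] at this
  exact fun i hi => down (1 - (α + 1 + β') - i).toNat i hi (by omega)

/-- Orders of vanishing at `0` and at `∞` may be checked separately. -/
theorem S_inter {α β α' β' : ℤ} {F : LaurentSeries ℂ} (h : F ∈ S α β') (h' : F ∈ S α' β) :
    F ∈ S α β := by
  have up (k : ℕ) (hk : α' + k ≤ α) : F ∈ S (α' + k) β := by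
    induction k with
    | zero => simpa using h'
    | succ k ih =>
      push_cast at hk ⊢
      rw [← add_assoc]
      exact S_inter_one (ih (by omega)) (S_mono h (by omega) le_rfl)
  rcases le_total α α' with hα | hα
  · exact S_mono h' hα le_rfl
  · have := up (α - α').toNat (by omega)
    rwa [show α' + ((α - α').toNat : ℤ) = α by omega] at this

/-- The expansion of `1` in the functions `x ^ e * (x - 1) ^ (-e - i)`, truncated at `i = p`. -/
noncomputable def T (e : ℤ) (p : ℕ) : LaurentSeries ℂ :=
  ∑ i ∈ Finset.range (p + 1), cbinom (-e) i • (X ^ e * Z ^ (-e - i))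

theorem pascal_sum_step {N : Type*} [AddCommGroup N] [Module ℂ N] (t t' : ℕ → N)
    (ht : ∀ i, t' i = t (i + 1) + t i) (e : ℤ) (p : ℕ) :
    ∑ i ∈ Finset.range (p + 1), cbinom (-(e + 1)) i • t' i =
      ∑ i ∈ Finset.range (p + 1), cbinom (-e) i • t i + cbinom (-(e + 1)) p • t (p + 1) := by
  induction p with
  | zero => simp [cbinom_zero_right, ht, add_comm]
  | succ p ih =>
    rw [Finset.sum_range_succ, ih, Finset.sum_range_succ _ (p + 1), ht,
      show -e = -(e + 1) + 1 by ring, cbinom_succ_succ]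
    module

/-- If a family `t e i` satisfies the relation of the functions `x ^ e * y ^ i * (x - y) ^ (-e - i)`,
then the truncated binomial sum is congruent to `t 0 0` modulo the terms `t e' (p + 1)` with `e'`
between `0` and `e`. -/
theorem pascal_sum_sub_mem {N : Type*} [AddCommGroup N] [Module ℂ N] (W : Submodule ℂ N)
    (t : ℤ → ℕ → N) (ht : ∀ e i, t (e + 1) i = t e (i + 1) + t e i) (p : ℕ) (e : ℤ)
    (hW : ∀ e', min e 0 ≤ e' → e' < max e 0 → t e' (p + 1) ∈ W) :
    ∑ i ∈ Finset.range (p + 1), cbinom (-e) i • t e i - t 0 0 ∈ W := by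
  have up (k : ℕ) (h : ∀ e' : ℤ, 0 ≤ e' → e' < k → t e' (p + 1) ∈ W) :
      ∑ i ∈ Finset.range (p + 1), cbinom (-(k : ℤ)) i • t k i - t 0 0 ∈ W := by
    induction k with
    | zero => simp [Finset.sum_range_succ', cbinom_zero_right, cbinom_zero_succ]
    | succ k ih =>
      push_cast at h ⊢
      rw [pascal_sum_step (t k) (t (k + 1)) (ht k), add_sub_right_comm]
      exact W.add_mem (ih fun e' h0 h1 => h e' h0 (by omega))
        (W.smul_mem _ (h k (by omega) (by omega)))
  have down (k : ℕ) (h : ∀ e' : ℤ, -k ≤ e' → e' < 0 → t e' (p + 1) ∈ W) :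
      ∑ i ∈ Finset.range (p + 1), cbinom (-(-(k : ℤ))) i • t (-k) i - t 0 0 ∈ W := by
    induction k with
    | zero => simp [Finset.sum_range_succ', cbinom_zero_right, cbinom_zero_succ]
    | succ k ih =>
      push_cast at h ⊢
      have h1 := ih fun e' h0 h1 => h e' (by omega) h1
      have h2 := pascal_sum_step (t (-(k + 1 : ℤ))) (t (-(k + 1 : ℤ) + 1)) (ht _) (-(k + 1 : ℤ)) p
      rw [show -(k + 1 : ℤ) + 1 = -k by ring] at h2
      rw [h2, add_sub_right_comm] at h1
      exact (W.add_mem_iff_left (W.smul_mem _ (h _ (by omega) (by omega)))).1 h1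
  rcases le_total 0 e with he | he
  · obtain ⟨k, rfl⟩ := Int.eq_ofNat_of_zero_le he
    exact up k fun e' h0 h1 => hW e' (by simpa using h0) (by simpa using h1)
  · obtain ⟨k, hk⟩ := Int.eq_ofNat_of_zero_le (neg_nonneg.2 he)
    obtain rfl : e = -k := by omega
    exact down k fun e' h0 h1 => hW e' (by simpa using h0) (by simpa using h1)

theorem T_mem (e : ℤ) (p : ℕ) : T e p ∈ S e 0 :=
  Submodule.sum_mem _ fun i _ => Submodule.smul_mem _ _ (monomial_mem_S _ _ rfl (by omega))

theorem T_sub_one_mem (e : ℤ) (p : ℕ) : T e p - 1 ∈ S (min e 0) (p + 1) := by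
  have := pascal_sum_sub_mem (S (min e 0) (p + 1)) (fun e i => X ^ e * Z ^ (-e - i))
    (fun e i => ?_) p e fun e' h _ => ?_
  · simpa [T] using this
  · have hz : Z ^ (-e - i) = Z ^ (-(e + 1) - i) * Z := by
      rw [← zpow_add_one₀ Z_ne_zero]; congr 1; ring
    rw [hz, zpow_add_one₀ X_ne_zero,
      show -e - ((i + 1 : ℕ) : ℤ) = -(e + 1) - i by push_cast; ring]
    nth_rw 2 [X]
    ring
  · refine S_mono (monomial_mem_S e' _ rfl ?_ : _ ∈ S e' (p + 1)) h le_rfl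
    push_cast; omega

theorem one_mem_S : (1 : LaurentSeries ℂ) ∈ S 0 0 := by
  simpa using monomial_mem_S 0 0 (α := 0) (β := 0) rfl (by simp)

theorem X_zpow_mem (s : ℤ) : X ^ s ∈ S s (-s) := by
  simpa using monomial_mem_S s 0 (α := s) (β := -s) rfl (by simp)

theorem Z_zpow_mem (s : ℤ) : Z ^ s ∈ S 0 (-s) := by
  simpa using monomial_mem_S 0 s (α := 0) (β := -s) rfl (by simp)

/-- The `j`-th Hasse derivative of Laurent series. -/
noncomputable abbrev D (j : ℕ) : LaurentSeries ℂ →ₗ[ℂ] LaurentSeries ℂ :=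
  LaurentSeries.hasseDeriv ℂ j

theorem coeff_D (j : ℕ) (F : LaurentSeries ℂ) (n : ℤ) :
    (D j F).coeff n = cbinom (n + j) j * F.coeff (n + j) := by
  rw [LaurentSeries.hasseDeriv_coeff, cbinom_eq_choose, zsmul_eq_mul]

theorem coeff_D_one (F : LaurentSeries ℂ) (n : ℤ) :
    (D 1 F).coeff n = (n + 1) * F.coeff (n + 1) := by
  rw [coeff_D]; simp [cbinom]

theorem D_succ (j : ℕ) (F : LaurentSeries ℂ) : ((j : ℂ) + 1) • D (j + 1) F = D 1 (D j F) := by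
  rw [LaurentSeries.hasseDeriv_comp, add_comm 1 j, Nat.choose_one_right]
  rw [← Nat.cast_smul_eq_nsmul ℂ]
  push_cast; rfl

/-- The Euler operator `x d/dx`. -/
noncomputable def euler (F : LaurentSeries ℂ) : LaurentSeries ℂ := X * D 1 F

theorem coeff_euler (F : LaurentSeries ℂ) (n : ℤ) :
    (euler F).coeff n = (n + 1) * F.coeff (n + 1) + n * F.coeff n := by
  rw [euler, coeff_X_mul, coeff_D_one, coeff_D_one]
  push_cast; ring_nf

theorem euler_X_mul (F : LaurentSeries ℂ) : euler (X * F) = X * F + X * euler F := by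
  ext n
  simp only [HahnSeries.coeff_add, coeff_X_mul, coeff_euler]
  rw [add_sub_cancel_right, sub_add_cancel]
  push_cast; ring

theorem euler_X_zpow_mul (k : ℤ) (F : LaurentSeries ℂ) :
    euler (X ^ k * F) = (k : ℂ) • (X ^ k * F) + X ^ k * euler F := by
  induction k using Int.induction_on with
  | zero => ext n; simp
  | succ k ih =>
    rw [add_comm (k : ℤ), zpow_one_add₀ X_ne_zero, mul_assoc, euler_X_mul, ih, mul_add,
      mul_smul_comm, mul_assoc]
    push_cast; module
  | pred k ih =>
    have h : X ^ (-k : ℤ) = X * X ^ (-k - 1 : ℤ) := by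
      rw [← zpow_one_add₀ X_ne_zero]; congr 1; ring
    rw [h, mul_assoc, euler_X_mul, mul_assoc, ← mul_smul_comm, ← mul_add, ← mul_add] at ih
    rw [← sub_eq_iff_eq_add'.2 (mul_left_cancel₀ X_ne_zero ih).symm]
    push_cast; module

theorem euler_mem_S {α β : ℤ} {F : LaurentSeries ℂ} (hF : F ∈ S α β) : euler F ∈ S α β := by
  have h := euler_X_zpow_mul (-α) F
  intro i hi
  rw [← sub_eq_iff_eq_add'.2 h, HahnSeries.coeff_sub, coeff_euler, HahnSeries.coeff_smul,
    hF i hi, hF (i + 1) (by omega)]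
  simp

/-- The divided power `binom (euler + B) j`, acting on Laurent series. -/
noncomputable def twistD (B : ℤ) (j : ℕ) (F : LaurentSeries ℂ) : LaurentSeries ℂ :=
  X ^ (-B + j) * D j (X ^ B * F)

theorem twistD_zero (B : ℤ) (F : LaurentSeries ℂ) : twistD B 0 F = F := by
  rw [twistD, D, LaurentSeries.hasseDeriv_zero, LinearMap.id_apply, ← mul_assoc,
    ← zpow_add₀ X_ne_zero]
  simp

theorem twistD_succ (B : ℤ) (j : ℕ) (F : LaurentSeries ℂ) :
    ((j : ℂ) + 1) • twistD B (j + 1) F = euler (twistD B j F) + ((B : ℂ) - j) • twistD B j F := by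
  have h := euler_X_zpow_mul (-B + j) (D j (X ^ B * F))
  rw [twistD, twistD, h, ← mul_smul_comm, D_succ, euler, ← mul_assoc, ← zpow_add_one₀ X_ne_zero]
  rw [show -B + ((j + 1 : ℕ) : ℤ) = -B + j + 1 by push_cast; ring]
  push_cast
  module

theorem twistD_sub (B : ℤ) (j : ℕ) (F G : LaurentSeries ℂ) :
    twistD B j (F - G) = twistD B j F - twistD B j G := by
  simp only [twistD, mul_sub, map_sub]

theorem twistD_mem_S (B : ℤ) (j : ℕ) {α β : ℤ} {F : LaurentSeries ℂ} (hF : F ∈ S α β) :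
    twistD B j F ∈ S α β := by
  induction j with
  | zero => rwa [twistD_zero]
  | succ j ih =>
    have hj : (j : ℂ) + 1 ≠ 0 := by exact_mod_cast j.succ_ne_zero
    rw [← Submodule.smul_mem_iff _ hj, twistD_succ]
    exact Submodule.add_mem _ (euler_mem_S ih) (Submodule.smul_mem _ _ ih)

theorem twistD_one (B : ℤ) (j : ℕ) : twistD B j 1 = cbinom B j • 1 := by
  induction j with
  | zero => rw [twistD_zero, cbinom_zero_right, one_smul]
  | succ j ih =>
    have hj : (j : ℂ) + 1 ≠ 0 := by exact_mod_cast j.succ_ne_zero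
    have he : euler (cbinom B j • 1) = 0 := by
      ext n
      rw [coeff_euler, HahnSeries.coeff_smul, HahnSeries.coeff_smul, HahnSeries.coeff_one,
        HahnSeries.coeff_one]
      rcases eq_or_ne n 0 with rfl | h1
      · simp
      rcases eq_or_ne (n + 1) 0 with h2 | h2
      · have : (n : ℂ) + 1 = 0 := by exact_mod_cast h2
        simp [h1, this]
      · simp [h1, h2]
    refine smul_right_injective _ hj ?_
    simp only
    rw [twistD_succ, ih, he, cbinom_succ_right, zero_add, smul_smul, smul_smul]
    congr 1
    field_simp

/-- Laurent series with vanishing coefficients in degrees below `N`. -/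
def ordGE (N : ℤ) : Submodule ℂ (LaurentSeries ℂ) where
  carrier := {F | ∀ i < N, F.coeff i = 0}
  add_mem' hF hG i hi := by rw [HahnSeries.coeff_add, hF i hi, hG i hi, add_zero]
  zero_mem' i _ := by simp
  smul_mem' c F hF i hi := by rw [HahnSeries.coeff_smul, hF i hi, smul_zero]

theorem mem_ordGE_order (F : LaurentSeries ℂ) : F ∈ ordGE F.order :=
  fun _ hi => HahnSeries.coeff_eq_zero_of_lt_order hi

theorem ordGE_mono {M N : ℤ} {F : LaurentSeries ℂ} (hF : F ∈ ordGE N) (h : M ≤ N) : F ∈ ordGE M :=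
  fun i hi => hF i (by omega)

theorem mul_mem_ordGE {M N K : ℤ} {F G : LaurentSeries ℂ} (hF : F ∈ ordGE M) (hG : G ∈ ordGE N)
    (hK : K ≤ M + N) : F * G ∈ ordGE K := by
  intro i hi
  rw [HahnSeries.coeff_mul]
  refine Finset.sum_eq_zero fun p hp => ?_
  have hp := (Finset.mem_antidiagonal.1 hp).2.2
  rcases lt_or_ge p.1 M with h1 | h1
  · rw [hF _ h1, zero_mul]
  · rw [hG _ (by omega), mul_zero]

theorem Z_zpow_mem_ordGE (k : ℤ) : Z ^ k ∈ ordGE k := by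
  intro i hi
  rw [coeff_Z_zpow, if_neg (by omega)]

theorem D_mem_ordGE (j : ℕ) {N : ℤ} {F : LaurentSeries ℂ} (hF : F ∈ ordGE N) :
    D j F ∈ ordGE (N - j) := by
  intro i hi
  rw [coeff_D, hF _ (by omega), mul_zero]

theorem D_Z_zpow (j : ℕ) (k : ℤ) : D j (Z ^ k) = cbinom k j • Z ^ (k - j) := by
  ext n
  rw [coeff_D, HahnSeries.coeff_smul, coeff_Z_zpow, coeff_Z_zpow, smul_eq_mul]
  by_cases h : n + j = k
  · rw [if_pos h, if_pos (by omega), h]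
  · rw [if_neg h, if_neg (by omega), mul_zero, mul_zero]

theorem exists_approx {p N : ℤ} {F : LaurentSeries ℂ} (hF : F ∈ ordGE p) (hN : p ≤ N) :
    ∃ s ∈ Submodule.span ℂ (Set.range fun k : ℤ => Z ^ k), s ∈ ordGE p ∧ F - s ∈ ordGE N := by
  have h2 : F - ∑ k ∈ Finset.Ico p N, F.coeff k • Z ^ k ∈ ordGE N := by
    intro i hi
    rw [HahnSeries.coeff_sub, HahnSeries.coeff_sum]
    simp only [HahnSeries.coeff_smul, coeff_Z_zpow, smul_eq_mul, mul_ite, mul_one, mul_zero,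
      Finset.sum_ite_eq, Finset.mem_Ico]
    split_ifs with h
    · rw [sub_self]
    · rw [hF i (by omega), sub_zero]
  refine ⟨_, Submodule.sum_mem _ fun k _ => Submodule.smul_mem _ _ (Submodule.subset_span ⟨k, rfl⟩),
    ?_, h2⟩
  simpa using (ordGE p).sub_mem hF (ordGE_mono h2 hN)

/-- A bilinear map on Laurent series which vanishes on monomials and is continuous in each variable
(uniformly for the other variable of bounded order) is zero. -/
theorem bilin_eq_zero {U : Type*} [AddCommGroup U] [Module ℂ U]
    (B : LaurentSeries ℂ →ₗ[ℂ] LaurentSeries ℂ →ₗ[ℂ] U)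
    (hl : ∀ q : ℤ, ∃ N : ℤ, ∀ g ∈ ordGE N, ∀ h ∈ ordGE q, B g h = 0)
    (hr : ∀ p : ℤ, ∃ N : ℤ, ∀ g ∈ ordGE p, ∀ h ∈ ordGE N, B g h = 0)
    (hm : ∀ P Q : ℤ, B (Z ^ P) (Z ^ Q) = 0) (g h : LaurentSeries ℂ) : B g h = 0 := by
  obtain ⟨N, hN⟩ := hl h.order
  obtain ⟨M, hM⟩ := hr g.order
  obtain ⟨s, hs, hs', hgs⟩ := exists_approx (mem_ordGE_order g) (le_max_left g.order N)
  obtain ⟨t, ht, -, hht⟩ := exists_approx (mem_ordGE_order h) (le_max_left h.order M)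
  have h1 := hN _ (ordGE_mono hgs (le_max_right _ _)) h (mem_ordGE_order h)
  have h2 := hM s hs' _ (ordGE_mono hht (le_max_right _ _))
  have h3 : B s t = 0 := by
    have hZ (P : ℤ) : B (Z ^ P) t = 0 := by
      have : Submodule.span ℂ (Set.range fun k : ℤ => Z ^ k) ≤ LinearMap.ker (B (Z ^ P)) :=
        Submodule.span_le.2 (by rintro _ ⟨Q, rfl⟩; exact hm P Q)
      exact this ht
    have : Submodule.span ℂ (Set.range fun k : ℤ => Z ^ k) ≤ LinearMap.ker (B.flip t) :=
      Submodule.span_le.2 (by rintro _ ⟨P, rfl⟩; exact hZ P)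
    exact this hs
  rw [map_sub, LinearMap.sub_apply, sub_eq_zero] at h1
  rw [map_sub, h3, sub_zero] at h2
  rw [h1, h2]

end ResCalc

namespace VOA

open ResCalc

theorem finite_support_res (d : VOA V) (a c : V) (F : LaurentSeries ℂ) :
    (Function.support fun i : ℤ => F.coeff i • d.mode a i c).Finite := by
  obtain ⟨N, hN⟩ := d.truncation a c
  refine (Set.finite_Icc F.order N).subset fun i hi => ?_
  rw [Function.mem_support] at hi
  contrapose! hi
  rw [Set.mem_Icc, not_and_or, not_le, not_le] at hi
  rcases hi with hi | hi
  · rw [HahnSeries.coeff_eq_zero_of_lt_order hi, zero_smul]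
  · rw [hN i hi.le, smul_zero]

/-- `Res_z F(z) Y(a, z) c`. -/
noncomputable def res (d : VOA V) : V →ₗ[ℂ] LaurentSeries ℂ →ₗ[ℂ] V →ₗ[ℂ] V where
  toFun a := LinearMap.mk₂ ℂ (fun F c => ∑ᶠ i : ℤ, F.coeff i • d.mode a i c)
    (fun F G c => by
      rw [← finsum_add_distrib (finite_support_res d a c F) (finite_support_res d a c G)]
      simp only [HahnSeries.coeff_add, add_smul])
    (fun r F c => by
      rw [smul_finsum]
      simp only [HahnSeries.coeff_smul, smul_assoc])
    (fun F c e => by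
      rw [← finsum_add_distrib (finite_support_res d a c F) (finite_support_res d a e F)]
      simp only [map_add, smul_add])
    (fun r F c => by
      rw [smul_finsum]
      simp only [map_smul, smul_comm r])
  map_add' a b := by
    ext F c
    simp only [LinearMap.mk₂_apply, LinearMap.add_apply]
    rw [← finsum_add_distrib (finite_support_res d a c F) (finite_support_res d b c F)]
    simp only [d.mode_add, LinearMap.add_apply, smul_add]
  map_smul' r a := by
    ext F c
    simp only [LinearMap.mk₂_apply, LinearMap.smul_apply, RingHom.id_apply]
    rw [smul_finsum]
    simp only [d.mode_smul, LinearMap.smul_apply, smul_comm r]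

theorem res_apply (d : VOA V) (a c : V) (F : LaurentSeries ℂ) :
    d.res a F c = ∑ᶠ i : ℤ, F.coeff i • d.mode a i c := rfl

theorem res_eq_zero (d : VOA V) {a c : V} {N : ℤ} (hN : ∀ n, N ≤ n → d.mode a n c = 0)
    {F : LaurentSeries ℂ} (hF : F ∈ ordGE N) : d.res a F c = 0 := by
  rw [res_apply, finsum_eq_zero_of_forall_eq_zero]
  intro i
  rcases lt_or_ge i N with hi | hi
  · rw [hF i hi, zero_smul]
  · rw [hN i hi, smul_zero]

theorem res_Z_zpow (d : VOA V) (a c : V) (k : ℤ) : d.res a (Z ^ k) c = d.mode a k c := by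
  rw [res_apply, finsum_eq_single _ k]
  · rw [coeff_Z_zpow, if_pos rfl, one_smul]
  · intro i hi
    rw [coeff_Z_zpow, if_neg hi, zero_smul]

theorem hres_eq_res (d : VOA V) (N k : ℤ) (u v : V) :
    d.hres N k u v = d.res u (X ^ N * Z ^ (-k)) v := by
  have hinj : Function.Injective fun i : ℕ => (i : ℤ) - k := fun i j h => by
    simpa using h
  rw [hres, res_apply, ← finsum_mem_univ (fun i : ℤ => (X ^ N * Z ^ (-k)).coeff i • d.mode u i v),
    finsum_mem_inter_support_eq' _ Set.univ (Set.range fun i : ℕ => (i : ℤ) - k),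
    finsum_mem_range hinj]
  · refine finsum_congr fun i => ?_
    rw [coeff_mul_Z_zpow, sub_neg_eq_add, sub_add_cancel, coeff_X_zpow_natCast]
  · intro i hi
    refine ⟨fun _ => ?_, fun _ => trivial⟩
    rw [Function.mem_support] at hi
    contrapose! hi
    rw [coeff_mul_Z_zpow, coeff_X_zpow_of_neg, zero_smul]
    by_contra h
    exact hi ⟨(i + k).toNat, by simp only; omega⟩

theorem finite_support_iterRes (d : VOA V) (a b c : V) (r : ℤ) (g h : LaurentSeries ℂ) :
    (Function.support fun l : ℕ => ((-1 : ℂ) ^ l * cbinom r l) •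
      d.res a (g * Z ^ (r - l)) (d.res b (h * Z ^ (l : ℤ)) c)).Finite := by
  obtain ⟨N, hN⟩ := d.truncation b c
  refine (Set.finite_Iic (N - h.order).toNat).subset fun l hl => ?_
  rw [Function.mem_support] at hl
  contrapose! hl
  rw [Set.mem_Iic, not_le] at hl
  rw [d.res_eq_zero hN (mul_mem_ordGE (mem_ordGE_order h) (Z_zpow_mem_ordGE l) (by omega)),
    map_zero, smul_zero]

/-- `Res_z Res_w g(z) h(w) (z - w) ^ r Y(a, z) Y(b, w) c`, with `(z - w) ^ r` expanded in the region
`|z| > |w|`. -/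
noncomputable def iterRes (d : VOA V) (a b c : V) (r : ℤ) :
    LaurentSeries ℂ →ₗ[ℂ] LaurentSeries ℂ →ₗ[ℂ] V :=
  LinearMap.mk₂ ℂ (fun g h => ∑ᶠ l : ℕ, ((-1 : ℂ) ^ l * cbinom r l) •
      d.res a (g * Z ^ (r - l)) (d.res b (h * Z ^ (l : ℤ)) c))
    (fun g g' h => by
      rw [← finsum_add_distrib (d.finite_support_iterRes a b c r g h)
        (d.finite_support_iterRes a b c r g' h)]
      simp only [add_mul, map_add, LinearMap.add_apply, smul_add])
    (fun t g h => by
      rw [smul_finsum]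
      simp only [smul_mul_assoc, map_smul, LinearMap.smul_apply, smul_comm t])
    (fun g h h' => by
      rw [← finsum_add_distrib (d.finite_support_iterRes a b c r g h)
        (d.finite_support_iterRes a b c r g h')]
      simp only [add_mul, map_add, LinearMap.add_apply, smul_add])
    (fun t g h => by
      rw [smul_finsum]
      simp only [smul_mul_assoc, map_smul, LinearMap.smul_apply, smul_comm t])

theorem iterRes_apply (d : VOA V) (a b c : V) (r : ℤ) (g h : LaurentSeries ℂ) :
    d.iterRes a b c r g h = ∑ᶠ l : ℕ, ((-1 : ℂ) ^ l * cbinom r l) •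
      d.res a (g * Z ^ (r - l)) (d.res b (h * Z ^ (l : ℤ)) c) := rfl

theorem finite_support_assocRes (d : VOA V) (a b c : V) (r : ℤ) (g h : LaurentSeries ℂ) :
    (Function.support fun j : ℕ => d.res (d.mode a (r + j) b) (h * D j g) c).Finite := by
  obtain ⟨N, hN⟩ := d.truncation a b
  refine (Set.finite_Iic (N - r).toNat).subset fun l hl => ?_
  rw [Function.mem_support] at hl
  contrapose! hl
  rw [Set.mem_Iic, not_le] at hl
  rw [hN _ (by omega), map_zero, LinearMap.zero_apply, LinearMap.zero_apply]

/-- `Res_w Res_{z - w} g(z) h(w) (z - w) ^ r Y(Y(a, z - w) b, w) c`, with `g(z)` expanded around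
`z = w`. -/
noncomputable def assocRes (d : VOA V) (a b c : V) (r : ℤ) :
    LaurentSeries ℂ →ₗ[ℂ] LaurentSeries ℂ →ₗ[ℂ] V :=
  LinearMap.mk₂ ℂ (fun g h => ∑ᶠ j : ℕ, d.res (d.mode a (r + j) b) (h * D j g) c)
    (fun g g' h => by
      rw [← finsum_add_distrib (d.finite_support_assocRes a b c r g h)
        (d.finite_support_assocRes a b c r g' h)]
      simp only [mul_add, map_add, LinearMap.add_apply])
    (fun t g h => by
      rw [smul_finsum]
      simp only [mul_smul_comm, map_smul, LinearMap.smul_apply])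
    (fun g h h' => by
      rw [← finsum_add_distrib (d.finite_support_assocRes a b c r g h)
        (d.finite_support_assocRes a b c r g h')]
      simp only [add_mul, map_add, LinearMap.add_apply])
    (fun t g h => by
      rw [smul_finsum]
      simp only [smul_mul_assoc, map_smul, LinearMap.smul_apply])

theorem assocRes_apply (d : VOA V) (a b c : V) (r : ℤ) (g h : LaurentSeries ℂ) :
    d.assocRes a b c r g h = ∑ᶠ j : ℕ, d.res (d.mode a (r + j) b) (h * D j g) c := rfl

theorem iterRes_eq_zero_right (d : VOA V) (a b c : V) (r : ℤ) :
    ∃ N : ℤ, ∀ g, ∀ h ∈ ordGE N, d.iterRes a b c r g h = 0 := by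
  obtain ⟨N, hN⟩ := d.truncation b c
  refine ⟨N, fun g h hh => ?_⟩
  rw [iterRes_apply, finsum_eq_zero_of_forall_eq_zero]
  intro l
  rw [d.res_eq_zero hN (mul_mem_ordGE hh (Z_zpow_mem_ordGE l) (by omega)), map_zero, smul_zero]

theorem exists_trunc_finset (d : VOA V) (a : V) (f : ℤ → V) (s : Finset ℤ) :
    ∃ N : ℤ, ∀ k ∈ s, ∀ n, N ≤ n → d.mode a n (f k) = 0 := by
  choose N hN using fun k => d.truncation a (f k)
  obtain ⟨M, hM⟩ := (s.image N).bddAbove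
  exact ⟨M, fun k hk n hn => hN k n ((hM (by simpa using ⟨k, hk, rfl⟩)).trans hn)⟩

theorem iterRes_eq_zero_left (d : VOA V) (a b c : V) (r q : ℤ) :
    ∃ N : ℤ, ∀ g ∈ ordGE N, ∀ h ∈ ordGE q, d.iterRes a b c r g h = 0 := by
  obtain ⟨M, hM⟩ := d.truncation b c
  obtain ⟨N, hN⟩ := d.exists_trunc_finset a (fun k => d.mode b k c) (Finset.Ico q M)
  refine ⟨N - r + (M - q).toNat, fun g hg h hh => ?_⟩
  rw [iterRes_apply, finsum_eq_zero_of_forall_eq_zero]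
  intro l
  rcases le_total (M - q) l with hl | hl
  · rw [d.res_eq_zero hM (mul_mem_ordGE hh (Z_zpow_mem_ordGE l) (by omega)), map_zero, smul_zero]
  · rw [d.res_eq_zero (N := N) _
      (mul_mem_ordGE hg (Z_zpow_mem_ordGE (r - l)) (by omega)), smul_zero]
    intro n hn
    rw [res_apply, map_finsum _ (finite_support_res d b c _), finsum_eq_zero_of_forall_eq_zero]
    intro i
    rw [map_smul]
    rcases lt_or_ge i q with hi | hi
    · rw [mul_mem_ordGE hh (Z_zpow_mem_ordGE l) (by omega : q ≤ _) i hi, zero_smul]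
    rcases lt_or_ge i M with hi' | hi'
    · rw [hN i (Finset.mem_Ico.2 ⟨hi, hi'⟩) n hn, smul_zero]
    · rw [hM i hi', map_zero, smul_zero]

theorem assocRes_eq_zero (d : VOA V) (a b c : V) (r : ℤ) :
    ∃ N : ℤ, ∀ g h, ∀ q q', g ∈ ordGE q → h ∈ ordGE q' → N ≤ q + q' →
      d.assocRes a b c r g h = 0 := by
  obtain ⟨M, hM⟩ := d.truncation a b
  choose N hN using fun k => d.truncation (d.mode a k b) c
  obtain ⟨K, hK⟩ := ((Finset.Ico r M).image N).bddAbove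
  refine ⟨K + (M - r).toNat, fun g h q q' hg hh hq => ?_⟩
  rw [assocRes_apply, finsum_eq_zero_of_forall_eq_zero]
  intro j
  rcases le_or_gt M (r + j) with hj | hj
  · rw [hM _ hj, map_zero, LinearMap.zero_apply, LinearMap.zero_apply]
  · refine d.res_eq_zero (hN _) (mul_mem_ordGE hh (D_mem_ordGE j hg) ?_)
    have := hK (Finset.mem_coe.2 (Finset.mem_image_of_mem N (Finset.mem_Ico.2 ⟨(by omega), hj⟩)))
    omega

/-- The Jacobi identity. -/
theorem assocRes_eq (d : VOA V) (a b c : V) (r : ℤ) (g h : LaurentSeries ℂ) :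
    d.assocRes a b c r g h = d.iterRes a b c r g h - (-1 : ℂ) ^ r • d.iterRes b a c r h g := by
  have := bilin_eq_zero
    (d.assocRes a b c r - (d.iterRes a b c r - (-1 : ℂ) ^ r • (d.iterRes b a c r).flip))
    (fun q => ?_) (fun p => ?_) (fun P Q => ?_) g h
  · simpa [sub_eq_zero] using this
  · obtain ⟨N₁, h₁⟩ := d.iterRes_eq_zero_left a b c r q
    obtain ⟨N₂, h₂⟩ := d.iterRes_eq_zero_right b a c r
    obtain ⟨N₃, h₃⟩ := d.assocRes_eq_zero a b c r
    refine ⟨max N₁ (max N₂ (N₃ - q)), fun g hg h hh => ?_⟩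
    simp only [LinearMap.sub_apply, LinearMap.smul_apply, LinearMap.flip_apply]
    rw [h₁ g (ordGE_mono hg (by omega)) h hh, h₂ h g (ordGE_mono hg (by omega)),
      h₃ g h _ _ hg hh (by omega)]
    simp
  · obtain ⟨N₁, h₁⟩ := d.iterRes_eq_zero_left b a c r p
    obtain ⟨N₂, h₂⟩ := d.iterRes_eq_zero_right a b c r
    obtain ⟨N₃, h₃⟩ := d.assocRes_eq_zero a b c r
    refine ⟨max N₁ (max N₂ (N₃ - p)), fun g hg h hh => ?_⟩
    simp only [LinearMap.sub_apply, LinearMap.smul_apply, LinearMap.flip_apply]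
    rw [h₁ h (ordGE_mono hh (by omega)) g hg, h₂ g h (ordGE_mono hh (by omega)),
      h₃ g h _ _ hg hh (by omega)]
    simp
  · simp only [LinearMap.sub_apply, LinearMap.smul_apply, LinearMap.flip_apply]
    have hB := d.borcherds P Q r a b c
    rw [sub_eq_zero]
    rw [iterRes_apply, iterRes_apply, assocRes_apply, smul_finsum, ← finsum_sub_distrib]
    · convert hB using 1
      · refine finsum_congr fun i => ?_
        rw [D_Z_zpow, mul_smul_comm, ← zpow_add₀ Z_ne_zero, map_smul, LinearMap.smul_apply,
          res_Z_zpow, show Q + (P - i) = P + Q - i by ring]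
      · refine finsum_congr fun i => ?_
        simp only [← zpow_add₀ Z_ne_zero, res_Z_zpow]
        rw [smul_sub, smul_comm ((-1 : ℂ) ^ r), add_sub_assoc, add_sub_assoc]
    · exact d.finite_support_iterRes a b c r _ _
    · refine (d.finite_support_iterRes b a c r (Z ^ Q) (Z ^ P)).subset fun l hl => ?_
      rw [Function.mem_support] at hl ⊢
      exact fun h => hl (by rw [h, smul_zero])

/-- `Res_z (1 + z) ^ (wt a - 1) F(z) Y(a, z) c`, extended linearly from homogeneous `a`. -/
noncomputable def wres (d : VOA V) : V →ₗ[ℂ] LaurentSeries ℂ →ₗ[ℂ] V →ₗ[ℂ] V :=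
  DirectSum.toModule ℂ ℤ _ (fun r =>
    d.res.compl₁₂ (d.grading r).subtype (LinearMap.mulLeft ℂ (X ^ (r - 1)))) ∘ₗ
    (LinearEquiv.ofBijective (DirectSum.coeLinearMap d.grading) d.internal).symm.toLinearMap

theorem ofBijective_symm_of_mem (d : VOA V) {r : ℤ} {a : V} (ha : a ∈ d.grading r) :
    (LinearEquiv.ofBijective (DirectSum.coeLinearMap d.grading) d.internal).symm a =
      DirectSum.lof ℂ ℤ (fun m => d.grading m) r ⟨a, ha⟩ := by
  rw [LinearEquiv.symm_apply_eq, LinearEquiv.ofBijective_apply, DirectSum.coeLinearMap_lof]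

theorem wres_of_mem (d : VOA V) {r : ℤ} {a : V} (ha : a ∈ d.grading r) (F : LaurentSeries ℂ)
    (c : V) : d.wres a F c = d.res a (X ^ (r - 1) * F) c := by
  rw [wres, LinearMap.comp_apply, LinearEquiv.coe_coe, d.ofBijective_symm_of_mem ha,
    DirectSum.toModule_lof]
  rfl

/-- A linear condition on `V` may be checked on homogeneous vectors. -/
theorem homogeneous_induction (d : VOA V) {P : V → Prop} (h0 : P 0)
    (hadd : ∀ a b, P a → P b → P (a + b)) (hm : ∀ r, ∀ a ∈ d.grading r, P a) (a : V) : P a := by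
  obtain ⟨x, rfl⟩ := d.internal.2 a
  induction x using DirectSum.induction_on with
  | zero => rwa [map_zero]
  | of r y =>
    rw [← DirectSum.lof_eq_of ℂ, DirectSum.coeLinearMap_lof]
    exact hm r _ y.2
  | add x y hx hy => rw [map_add]; exact hadd _ _ hx hy

theorem bres_eq_wres (d : VOA V) (m k : ℤ) (u v : V) :
    d.bres m k u v = d.wres u (X ^ (m + 1) * Z ^ (-k)) v := by
  obtain ⟨x, rfl⟩ := d.internal.2 u
  have hx : (LinearEquiv.ofBijective (DirectSum.coeLinearMap d.grading) d.internal).symm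
      (DirectSum.coeLinearMap d.grading x) = x := LinearEquiv.symm_apply_apply _ x
  have hp (n : ℤ) : d.proj n (DirectSum.coeLinearMap d.grading x) = x n := by
    rw [proj, LinearMap.comp_apply, LinearMap.comp_apply, LinearEquiv.coe_coe, hx]
    rfl
  have hz (n : ℤ) (h : x n = 0) : d.hres (n + m) k (d.proj n (DirectSum.coeLinearMap d.grading x)) v
      = 0 := by
    rw [hp, h, hres_eq_res]
    simp
  classical
  rw [bres, finsum_eq_sum_of_support_subset (s := DFinsupp.support x)]
  · nth_rw 3 [← DirectSum.sum_support_of x]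
    rw [map_sum, map_sum, LinearMap.sum_apply, LinearMap.sum_apply]
    refine Finset.sum_congr rfl fun n _ => ?_
    rw [hp, hres_eq_res, ← DirectSum.lof_eq_of ℂ, DirectSum.coeLinearMap_lof,
      d.wres_of_mem (x n).2, ← mul_assoc, ← zpow_add₀ X_ne_zero,
      show n - 1 + (m + 1) = n + m by ring]
  · intro n hn
    rw [Function.mem_support] at hn
    rw [Finset.mem_coe, DFinsupp.mem_support_iff]
    exact fun h => hn (hz n h)

/-- The kernel of the product `*_{m,p}^n`. -/
noncomputable def starKer (m p n : ℕ) : LaurentSeries ℂ :=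
  X ^ ((p : ℤ) - n) * T ((m : ℤ) + n - p + 1) p

theorem starmpn_eq_wres (d : VOA V) (m p n : ℕ) (u v : V) :
    d.starmpn m p n u v = d.wres u (starKer m p n) v := by
  rw [starmpn, starKer, T, Finset.mul_sum, map_sum, LinearMap.sum_apply]
  refine Finset.sum_congr rfl fun i _ => ?_
  rw [bres_eq_wres, mul_smul_comm, map_smul, LinearMap.smul_apply, ← mul_assoc,
    ← zpow_add₀ X_ne_zero, show (p : ℤ) - n + (m + n - p + 1) = m + 1 by ring,
    show -((m : ℤ) + n - p + i + 1) = -(m + n - p) - 1 - i by ring,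
    show -((m : ℤ) + n - p + 1) = -(m + n - p) - 1 by ring, cbinom_neg]

/-- The subspace spanned by the first two families of generators of `O_{n,m}(V)`. -/
def O' (d : VOA V) (n m : ℕ) : Submodule ℂ V :=
  Submodule.span ℂ ({w : V | ∃ u v : V, w = d.circmn n m u v} ∪
    {w : V | ∃ u : V, w = d.mode d.conformal 0 u + d.mode d.conformal 1 u
        + (((m : ℂ) - (n : ℂ)) • u)})

theorem On_eq (d : VOA V) (n : ℕ) : d.On n = d.O' n n := by
  simp only [On, O', circn, circmn, sub_self, zero_smul, add_zero]
  rw [show 2 * (n : ℤ) + 2 = n + n + 2 by ring]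

theorem D_one_X_zpow_mul (r : ℤ) (F : LaurentSeries ℂ) :
    D 1 (X ^ r * F) = X ^ (r - 1) * ((r : ℂ) • F + euler F) := by
  apply mul_left_cancel₀ X_ne_zero
  rw [← mul_assoc, ← zpow_one_add₀ X_ne_zero, add_sub_cancel, mul_add, mul_smul_comm,
    ← euler_X_zpow_mul, euler]

theorem res_conformal_zero (d : VOA V) (a c : V) (F : LaurentSeries ℂ) :
    d.res (d.mode d.conformal 0 a) F c = -d.res a (D 1 F) c := by
  rw [res_apply, res_apply, ← finsum_neg_distrib, ← finsum_comp_equiv (Equiv.addRight (1 : ℤ))]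
  refine finsum_congr fun i => ?_
  rw [Equiv.coe_addRight, d.Lneg1_deriv, coeff_D_one, add_sub_cancel_right, LinearMap.smul_apply,
    smul_smul, ← neg_smul]
  congr 1
  push_cast
  ring

theorem res_mul_Z (d : VOA V) (a c : V) (F : LaurentSeries ℂ) :
    d.res a (Z * F) c = ∑ᶠ i : ℤ, F.coeff i • d.mode a (i + 1) c := by
  rw [res_apply, ← finsum_comp_equiv (Equiv.addRight (1 : ℤ))]
  refine finsum_congr fun i => ?_
  have := coeff_mul_Z_zpow F 1 (i + 1)
  rw [zpow_one, mul_comm, add_sub_cancel_right] at this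
  rw [Equiv.coe_addRight, this]

theorem finite_support_res_succ (d : VOA V) (a c : V) (F : LaurentSeries ℂ) :
    (Function.support fun i : ℤ => F.coeff i • d.mode a (i + 1) c).Finite := by
  refine ((d.finite_support_res a c (Z * F)).preimage (f := fun i => i + 1)
    (add_left_injective 1).injOn).subset fun i hi => ?_
  have := coeff_mul_Z_zpow F 1 (i + 1)
  rw [zpow_one, mul_comm, add_sub_cancel_right] at this
  rwa [Set.mem_preimage, Function.mem_support, this]

/-- The operator `L(-1) + L(0)`. -/
noncomputable def LL (d : VOA V) : Module.End ℂ V := d.mode d.conformal 0 + d.mode d.conformal 1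

theorem LL_mode (d : VOA V) (a c : V) (q : ℤ) :
    d.LL (d.mode a q c) - d.mode a q (d.LL c) = d.mode (d.mode d.conformal 0 a) q c +
      d.mode (d.mode d.conformal 0 a) (q + 1) c + d.mode (d.mode d.conformal 1 a) q c := by
  have hc (k : ℕ) (hk : k ≠ 0) : cbinom 0 k = 0 := by
    obtain ⟨k, rfl⟩ := Nat.exists_eq_succ_of_ne_zero hk
    exact cbinom_zero_succ k
  have hr (f : ℕ → V) : ∑ᶠ i : ℕ, ((-1 : ℂ) ^ i * cbinom 0 i) • f i = f 0 := by
    rw [finsum_eq_single _ 0 fun i hi => by rw [hc i hi, mul_zero, zero_smul], cbinom_zero_right]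
    simp
  have h0 := d.borcherds 0 q 0 d.conformal a c
  have h1 := d.borcherds 1 q 0 d.conformal a c
  rw [hr, finsum_eq_single _ 0 fun i hi => by rw [hc i hi, zero_smul], cbinom_zero_right] at h0
  rw [hr, finsum_eq_sum_of_support_subset (s := Finset.range 2), Finset.sum_range_succ,
    Finset.sum_range_one, cbinom_zero_right] at h1
  · have h11 : cbinom 1 1 = 1 := by simp [cbinom]
    rw [h11] at h1
    simp only [Nat.cast_zero, Nat.cast_one, one_smul, zpow_zero, zero_add, add_zero, sub_zero,
      add_sub_cancel_left] at h0 h1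
    rw [add_comm 1 q] at h1
    simp only [LL, LinearMap.add_apply, map_add]
    rw [add_assoc, h0, h1]
    abel
  · intro i hi
    rw [Function.mem_support] at hi
    contrapose! hi
    rw [Finset.coe_range, Set.mem_Iio, not_lt] at hi
    obtain ⟨k, rfl⟩ := Nat.exists_eq_add_of_le' hi
    have := cbinom_succ_succ 0 (k + 1)
    rw [zero_add, cbinom_zero_succ, cbinom_zero_succ, add_zero] at this
    rw [this, zero_smul]

theorem LL_res (d : VOA V) (a c : V) (F : LaurentSeries ℂ) :
    d.LL (d.res a F c) = d.res a F (d.LL c) - d.res a (D 1 (X * F)) c +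
      d.res (d.mode d.conformal 1 a) F c := by
  have hs := d.finite_support_res
  have hs' := d.finite_support_res_succ
  have : d.LL (d.res a F c) - d.res a F (d.LL c) = d.res (d.mode d.conformal 0 a) F c +
      d.res (d.mode d.conformal 0 a) (Z * F) c + d.res (d.mode d.conformal 1 a) F c := by
    rw [res_mul_Z, res_apply, res_apply, res_apply, res_apply, map_finsum _ (hs a c F)]
    simp only [map_smul]
    rw [← finsum_sub_distrib _ (hs _ _ F), ← finsum_add_distrib (hs _ _ F) (hs' _ _ F),
      ← finsum_add_distrib _ (hs _ _ F)]
    · simp only [← smul_sub, ← smul_add, LL_mode]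
    · refine ((hs _ _ F).union (hs' _ _ F)).subset (Function.support_add _ _)
    · refine (hs a c F).subset fun i hi => ?_
      rw [Function.mem_support] at hi ⊢
      contrapose! hi
      rw [← map_smul, hi, map_zero]
  rw [X, add_mul, one_mul, map_add, map_add, LinearMap.add_apply, ← sub_eq_zero]
  rw [res_conformal_zero, res_conformal_zero, ← sub_eq_zero] at this
  rw [← this]
  abel

theorem wres_LL_left (d : VOA V) (a c : V) (F : LaurentSeries ℂ) :
    d.wres (d.LL a) F c = -d.wres a (euler F) c := by
  induction a using d.homogeneous_induction with
  | h0 => simp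
  | hadd a b ha hb =>
    simp only [map_add, LinearMap.add_apply, ha, hb, neg_add]
  | hm r a ha =>
    have h := d.grading_mode 2 r 0 _ _ d.conformal_mem ha
    rw [LL, LinearMap.add_apply, map_add, LinearMap.add_apply, LinearMap.add_apply,
      d.wres_of_mem h, res_conformal_zero, d.L0_eigen r a ha, map_smul, LinearMap.smul_apply,
      LinearMap.smul_apply, d.wres_of_mem ha, d.wres_of_mem ha,
      show 2 + r - 0 - 1 - 1 = r by ring, D_one_X_zpow_mul, mul_add, map_add, LinearMap.add_apply,
      mul_smul_comm, map_smul, LinearMap.smul_apply]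
    abel

theorem LL_wres (d : VOA V) (a c : V) (F : LaurentSeries ℂ) :
    d.LL (d.wres a F c) = d.wres a F (d.LL c) - d.wres a (euler F) c := by
  induction a using d.homogeneous_induction with
  | h0 => simp
  | hadd a b ha hb =>
    simp only [map_add, LinearMap.add_apply, ha, hb]
    abel
  | hm r a ha =>
    rw [d.wres_of_mem ha, d.wres_of_mem ha, d.wres_of_mem ha, LL_res, d.L0_eigen r a ha, map_smul,
      LinearMap.smul_apply, LinearMap.smul_apply, ← mul_assoc, ← zpow_one_add₀ X_ne_zero,
      add_sub_cancel, D_one_X_zpow_mul, mul_add, map_add, LinearMap.add_apply,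
      mul_smul_comm, map_smul, LinearMap.smul_apply]
    abel

theorem euler_Z_zpow (k : ℤ) : euler (Z ^ k) = (k : ℂ) • (Z ^ (k - 1) + Z ^ k) := by
  ext n
  rw [coeff_euler, HahnSeries.coeff_smul, HahnSeries.coeff_add, coeff_Z_zpow, coeff_Z_zpow,
    coeff_Z_zpow, smul_eq_mul]
  by_cases h : n + 1 = k
  · subst h
    simp
  · by_cases h' : n = k
    · subst h'
      rw [if_neg h, if_pos rfl, if_neg (show ¬n = n - 1 by omega)]
      simp
    · rw [if_neg h, if_neg h', if_neg (by omega)]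
      simp

theorem wres_mem_O' (d : VOA V) {n m : ℕ} {F : LaurentSeries ℂ} (hF : F ∈ S (m + 1) (n + 1))
    (a c : V) : d.wres a F c ∈ d.O' n m := by
  have key (k : ℕ) : ∀ a, d.wres a (X ^ ((m : ℤ) + 1) * Z ^ (-(n + m + 2 + k) : ℤ)) c ∈
      d.O' n m := by
    induction k with
    | zero =>
      intro a
      refine Submodule.subset_span (Or.inl ⟨a, c, ?_⟩)
      rw [circmn, bres_eq_wres, Nat.cast_zero, add_zero]
    | succ k ih =>
      intro a
      have h := ih (d.LL a)
      have h' := ih a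
      rw [Nat.cast_succ, show (-(n + m + 2 + (k + 1)) : ℤ) = -(n + m + 2 + k) - 1 by ring]
      have hk : (-(n + m + 2 + k) : ℤ) ≠ 0 := by omega
      generalize (-(n + m + 2 + k) : ℤ) = K at h h' hk ⊢
      rw [wres_LL_left, euler_X_zpow_mul, euler_Z_zpow, mul_smul_comm, mul_add, map_add, map_smul,
        map_smul, map_add] at h
      simp only [LinearMap.add_apply, LinearMap.smul_apply] at h
      rw [← Submodule.smul_mem_iff _ (neg_ne_zero.2 (Int.cast_ne_zero.2 hk : (K : ℂ) ≠ 0))]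
      have h2 := (d.O' n m).add_mem h ((d.O' n m).smul_mem
        ((((m : ℤ) + 1 : ℤ) : ℂ) + (K : ℂ)) h')
      convert h2 using 1
      module
  have hF' : F = ∑ i ∈ Finset.Icc (X ^ (-((m : ℤ) + 1)) * F).order (-(n + m + 2)),
      (X ^ (-((m : ℤ) + 1)) * F).coeff i • (X ^ ((m : ℤ) + 1) * Z ^ i) := by
    apply mul_left_cancel₀ (zpow_ne_zero (-((m : ℤ) + 1)) X_ne_zero)
    rw [Finset.mul_sum]
    simp only [mul_smul_comm, ← mul_assoc, ← zpow_add₀ X_ne_zero, neg_add_cancel, zpow_zero,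
      one_mul]
    ext i
    simp only [HahnSeries.coeff_sum, HahnSeries.coeff_smul, coeff_Z_zpow, smul_eq_mul, mul_ite,
      mul_one, mul_zero, Finset.sum_ite_eq, Finset.mem_Icc]
    split_ifs with h
    · rfl
    · rcases not_and_or.1 h with h | h
      · exact HahnSeries.coeff_eq_zero_of_lt_order (not_le.1 h)
      · exact hF i (by omega)
  rw [hF', map_sum, LinearMap.sum_apply]
  refine Submodule.sum_mem _ fun i hi => ?_
  rw [map_smul, LinearMap.smul_apply]
  refine Submodule.smul_mem _ _ ?_
  have := key (-(n + m + 2) - i).toNat a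
  rwa [Int.toNat_of_nonneg (by linarith [(Finset.mem_Icc.1 hi).2]), show
    (-(n + m + 2 + (-(n + m + 2) - i)) : ℤ) = i by ring] at this

theorem iterRes_X_mul (d : VOA V) (a b c : V) (r : ℤ) (g h : LaurentSeries ℂ) :
    d.iterRes a b c r (X * g) h = d.iterRes a b c r g (X * h) + d.iterRes a b c (r + 1) g h := by
  obtain ⟨N, hN⟩ := d.truncation b c
  have hb (l : ℕ) (hl : (N - h.order).toNat ≤ l) : d.res b (h * Z ^ (l : ℤ)) c = 0 :=
    d.res_eq_zero hN (mul_mem_ordGE (mem_ordGE_order h) (Z_zpow_mem_ordGE l) (by omega))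
  generalize (N - h.order).toNat = M at hb
  have key (f : ℕ → V) (M : ℕ) :
      ∑ l ∈ Finset.range (M + 1), ((-1 : ℂ) ^ l * cbinom (r + 1) l) • f l =
      ∑ l ∈ Finset.range (M + 1), ((-1 : ℂ) ^ l * cbinom r l) • f l -
        ∑ l ∈ Finset.range M, ((-1 : ℂ) ^ l * cbinom r l) • f (l + 1) := by
    induction M with
    | zero => simp [cbinom_zero_right]
    | succ M ih =>
      rw [Finset.sum_range_succ, ih, Finset.sum_range_succ _ (M + 1), Finset.sum_range_succ _ M,
        Finset.sum_range_succ _ M, cbinom_succ_succ, pow_succ]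
      module
  have key := key (fun l => d.res a (g * Z ^ (r + 1 - l)) (d.res b (h * Z ^ (l : ℤ)) c)) M
  have hsum (f : ℕ → V) (K : ℕ) (hf : ∀ l, K ≤ l → f l = 0) :
      ∑ᶠ l, f l = ∑ l ∈ Finset.range K, f l := by
    refine finsum_eq_sum_of_support_subset _ fun l hl => ?_
    rw [Function.mem_support] at hl
    contrapose! hl
    exact hf l (by simpa using hl)
  have hZ (l : ℕ) : (Z * h) * Z ^ (l : ℤ) = h * Z ^ ((l + 1 : ℕ) : ℤ) := by
    rw [mul_comm Z, mul_assoc, ← zpow_one_add₀ Z_ne_zero, Nat.cast_succ, add_comm 1]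
  have hZ' (l : ℕ) : (Z * g) * Z ^ (r - l) = g * Z ^ (r + 1 - l) := by
    rw [mul_comm Z, mul_assoc, ← zpow_one_add₀ Z_ne_zero, show 1 + (r - l) = r + 1 - l by ring]
  have h1 : d.iterRes a b c r (Z * g) h =
      d.iterRes a b c r g (Z * h) + d.iterRes a b c (r + 1) g h := by
    rw [iterRes_apply, iterRes_apply, iterRes_apply, hsum _ (M + 1), hsum _ M, hsum _ (M + 1), key]
    · have hr (l : ℕ) : r + 1 - (l + 1 : ℕ) = r - l := by push_cast; ring
      simp only [hZ, hZ', hr]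
      abel
    · intro l hl
      rw [hb l (by omega), map_zero, smul_zero]
    · intro l hl
      rw [hZ, hb _ (by omega), map_zero, smul_zero]
    · intro l hl
      rw [hb l (by omega), map_zero, smul_zero]
  rw [X, add_mul, one_mul, add_mul, one_mul, map_add, map_add, LinearMap.add_apply, h1]
  abel

theorem iterRes_mem_O' (d : VOA V) {n m : ℕ} {wa : ℤ} {a : V} (ha : a ∈ d.grading wa) (b c : V)
    {r α β : ℤ} {G : LaurentSeries ℂ} (hG : G ∈ S α β) (hα : m + 1 ≤ α) (hβ : n + 1 ≤ β - r)
    (h : LaurentSeries ℂ) : d.iterRes a b c r (X ^ (wa - 1) * G) h ∈ d.O' n m := by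
  rw [iterRes_apply]
  refine finsum_induction (· ∈ d.O' n m) (zero_mem _) (fun _ _ => add_mem) fun l => ?_
  rw [mul_assoc, ← d.wres_of_mem ha]
  exact Submodule.smul_mem _ _ (d.wres_mem_O'
    (S_mono (mul_mem_S hG (Z_zpow_mem _) rfl le_rfl) (by omega) (by omega)) _ _)

theorem assocRes_eq_wres (d : VOA V) {wa wb : ℤ} {a b : V} (ha : a ∈ d.grading wa)
    (hb : b ∈ d.grading wb) (c : V) (r B : ℤ) (F h : LaurentSeries ℂ) :
    d.assocRes a b c r (X ^ B * F) (X ^ (wb - 1) * h) = ∑ᶠ j : ℕ,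
      d.wres (d.mode a (r + j) b) (X ^ (B + r + 1 - wa) * (h * twistD B j F)) c := by
  rw [assocRes_apply]
  refine finsum_congr fun j => ?_
  rw [d.wres_of_mem (d.grading_mode _ _ (r + j) _ _ ha hb), twistD]
  congr 2
  have : D j (X ^ B * F) = X ^ (B - j) * (X ^ (-B + j) * D j (X ^ B * F)) := by
    rw [← mul_assoc, ← zpow_add₀ X_ne_zero, show B - j + (-B + j) = 0 by ring, zpow_zero, one_mul]
  generalize X ^ (-B + j) * D j (X ^ B * F) = Q at this ⊢
  rw [this]
  rw [mul_mul_mul_comm]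
  simp only [← mul_assoc, ← zpow_add₀ X_ne_zero]
  congr 3
  ring

theorem iterRes_zero (d : VOA V) (a b c : V) (g h : LaurentSeries ℂ) :
    d.iterRes a b c 0 g h = d.res a g (d.res b h c) := by
  rw [iterRes_apply, finsum_eq_single _ 0]
  · simp [cbinom_zero_right]
  · intro i hi
    obtain ⟨k, rfl⟩ := Nat.exists_eq_succ_of_ne_zero hi
    rw [Nat.succ_eq_add_one, cbinom_zero_succ, mul_zero, zero_smul]

theorem X_zpow_mul_mem {m p n : ℕ} {α α' : ℤ} {G : LaurentSeries ℂ} (h : G ∈ S α 0)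
    (h' : G ∈ S α' (p + 1)) (hα : (m : ℤ) + n - p + 1 ≤ α) :
    X ^ ((p : ℤ) - n) * G ∈ S (m + 1) (n + 1) :=
  S_inter (S_mono (mul_mem_S (X_zpow_mem _) h rfl le_rfl) (by omega) le_rfl)
    (S_mono (mul_mem_S (X_zpow_mem _) h' rfl le_rfl) le_rfl (by omega))

theorem T_mem_of_le {α E : ℤ} {q : ℕ} (h : α ≤ E) : T E q ∈ S α 0 :=
  S_mono (T_mem E q) h le_rfl

theorem T_sub_one_mem_of_le {α E : ℤ} {p q : ℕ} (h : α ≤ E) (h0 : α ≤ 0) (hq : p ≤ q) :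
    T E q - 1 ∈ S α (p + 1) :=
  S_mono (T_sub_one_mem E q) (le_min h h0) (by omega)

theorem X_zpow_mul_T_sub_starKer_mem {m p n : ℕ} {E : ℤ} {q : ℕ} (hE : (m + 1 + n : ℤ) ≤ E)
    (hq : p ≤ q) : X ^ ((p : ℤ) - n) * T E q - starKer m p n ∈ S (m + 1) (n + 1) := by
  rw [starKer, ← mul_sub]
  have h : T E q ∈ S ((m : ℤ) + n - p + 1) 0 := T_mem_of_le (by omega)
  refine X_zpow_mul_mem (sub_mem h (T_mem _ p)) (α' := min (m + n - p + 1) 0) ?_ le_rfl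
  have h' : T E q - 1 ∈ S (min ((m : ℤ) + n - p + 1) 0) (p + 1) :=
    T_sub_one_mem_of_le (by omega) (by omega) hq
  have := sub_mem h' (T_sub_one_mem ((m : ℤ) + n - p + 1) p)
  rwa [sub_sub_sub_cancel_right] at this

theorem wres_starKer_wres_sub_mem (d : VOA V) {wa wb : ℤ} {a b : V} (ha : a ∈ d.grading wa)
    (hb : b ∈ d.grading wb) (c : V) (m n p₁ p₂ : ℕ) {K : LaurentSeries ℂ} {κ : ℤ}
    (hK : K ∈ S (m + 1) κ) (hκ : (p₂ : ℤ) - p₁ ≤ κ) {E : ℤ} {q : ℕ}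
    (hE : (m + 1 + n + p₂ : ℤ) ≤ E) (hq : p₂ ≤ q) :
    d.wres a (starKer m p₂ n) (d.wres b K c) -
      ∑ i ∈ Finset.range (p₂ + 1), cbinom (-((p₁ : ℤ) + n - p₂ + 1)) i • ∑ᶠ j : ℕ,
        d.wres (d.mode a (-((p₁ : ℤ) + n - p₂ + 1) - i + j) b)
          (X ^ ((p₂ : ℤ) - n) * (K * twistD (wa + p₁) j (T E q))) c ∈ d.O' n m := by
  set A : ℤ := p₂ - n with hA
  set e : ℤ := p₁ + n - p₂ + 1 with he
  have hG : X ^ A * T E q ∈ S (A + E) (-A) := mul_mem_S (X_zpow_mem _) (T_mem E q) rfl (by omega)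
  have h1 := pascal_sum_sub_mem (d.O' n m) (fun e' i => d.iterRes a b c (-e' - i)
    (X ^ (wa - 1) * (X ^ e' * (X ^ A * T E q))) (X ^ (wb - 1) * (X ^ (i : ℤ) * K)))
    (fun e' i => ?_) p₂ e fun e' h h' => ?_
  · have h2 : ∑ i ∈ Finset.range (p₂ + 1), cbinom (-e) i • (d.iterRes a b c (-e - i)
        (X ^ (wa - 1) * (X ^ e * (X ^ A * T E q))) (X ^ (wb - 1) * (X ^ (i : ℤ) * K)) -
        ∑ᶠ j : ℕ, d.wres (d.mode a (-e - i + j) b)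
          (X ^ A * (K * twistD (wa + p₁) j (T E q))) c) ∈ d.O' n m := by
      refine Submodule.sum_mem _ fun i _ => Submodule.smul_mem _ _ ?_
      have h3 := d.iterRes_mem_O' (n := n) (m := m) hb a c (r := -e - i)
        (mul_mem_S (X_zpow_mem i) hK rfl le_rfl)
        (by omega) (by omega) (X ^ (wa - 1) * (X ^ e * (X ^ A * T E q)))
      have h4 := d.assocRes_eq a b c (-e - i) (X ^ (wa - 1) * (X ^ e * (X ^ A * T E q)))
        (X ^ (wb - 1) * (X ^ (i : ℤ) * K))
      have h5 : X ^ (wa - 1) * (X ^ e * (X ^ A * T E q)) = X ^ (wa + p₁) * T E q := by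
        rw [← mul_assoc, ← mul_assoc, ← zpow_add₀ X_ne_zero, ← zpow_add₀ X_ne_zero,
          show wa - 1 + e + A = wa + p₁ by omega]
      have h6 (j : ℕ) : X ^ (wa + p₁ + (-e - i) + 1 - wa) * (X ^ (i : ℤ) * K *
          twistD (wa + p₁) j (T E q)) = X ^ A * (K * twistD (wa + p₁) j (T E q)) := by
        rw [mul_assoc (X ^ (i : ℤ)), ← mul_assoc, ← zpow_add₀ X_ne_zero,
          show wa + p₁ + (-e - i) + 1 - wa + i = A by omega]
      nth_rw 1 [h5] at h4
      rw [d.assocRes_eq_wres ha hb] at h4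
      simp only [h6] at h4
      rw [h4, sub_sub_cancel]
      exact Submodule.smul_mem _ _ h3
    have h3 := d.wres_mem_O' (X_zpow_mul_T_sub_starKer_mem (m := m) (p := p₂) (n := n)
      (E := E) (by omega) hq) a (d.wres b K c)
    simp only [neg_zero, Nat.cast_zero, sub_zero, zpow_zero, one_mul, iterRes_zero] at h1
    rw [← d.wres_of_mem ha, ← d.wres_of_mem hb] at h1
    simp only [smul_sub, Finset.sum_sub_distrib] at h2
    rw [map_sub, LinearMap.sub_apply] at h3
    have := (d.O' n m).sub_mem ((d.O' n m).sub_mem h2 h1) h3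
    convert this using 1
    abel
  · have := d.iterRes_X_mul a b c (-e' - 1 - i) (X ^ (wa - 1) * (X ^ e' * (X ^ A * T E q)))
      (X ^ (wb - 1) * (X ^ (i : ℤ) * K))
    have h1 : X ^ (wa - 1) * (X ^ (e' + 1) * (X ^ A * T E q)) =
        X * (X ^ (wa - 1) * (X ^ e' * (X ^ A * T E q))) := by
      rw [zpow_add_one₀ X_ne_zero]
      ring
    have h2 : X ^ (wb - 1) * (X ^ ((i + 1 : ℕ) : ℤ) * K) =
        X * (X ^ (wb - 1) * (X ^ (i : ℤ) * K)) := by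
      rw [Nat.cast_succ, zpow_add_one₀ X_ne_zero]
      ring
    rw [h1, h2, show -(e' + 1) - (i : ℤ) = -e' - 1 - i by ring,
      show -e' - ((i + 1 : ℕ) : ℤ) = -e' - 1 - i by push_cast; ring, this,
      show -e' - 1 - (i : ℤ) + 1 = -e' - i by ring]
  · refine d.iterRes_mem_O' ha b c (mul_mem_S (X_zpow_mem e') hG rfl le_rfl) ?_ ?_ _
    · omega
    · push_cast; omega

theorem euler_sub (F G : LaurentSeries ℂ) : euler (F - G) = euler F - euler G := by
  rw [euler, map_sub, mul_sub, euler, euler]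

theorem euler_one : euler 1 = 0 := by
  ext n
  rw [← zpow_zero Z, euler_Z_zpow, HahnSeries.coeff_smul, Int.cast_zero, zero_smul,
    HahnSeries.coeff_zero]

theorem X_zpow_mul_euler_T_mem (m p n : ℕ) :
    X ^ ((p : ℤ) - n) * euler (T ((m : ℤ) + n - p + 1) p) ∈ S (m + 1) (n + 1) := by
  refine X_zpow_mul_mem (euler_mem_S (T_mem _ _)) ?_ le_rfl (α' := min (m + n - p + 1) 0)
  have := euler_mem_S (T_sub_one_mem ((m : ℤ) + n - p + 1) p)
  rwa [euler_sub, euler_one, sub_zero] at this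

theorem euler_starKer (m p n : ℕ) : euler (starKer m p n) =
    ((p : ℂ) - n) • starKer m p n + X ^ ((p : ℤ) - n) * euler (T ((m : ℤ) + n - p + 1) p) := by
  rw [starKer, euler_X_zpow_mul]
  push_cast
  rfl

theorem starKer_mem (m p n : ℕ) : starKer m p n ∈ S (m + 1) (n - p) :=
  mul_mem_S (X_zpow_mem _) (T_mem _ p) (by omega) (by omega)

theorem LL_add_smul_mem (d : VOA V) (n m : ℕ) (u : V) :
    d.LL u + ((m : ℂ) - n) • u ∈ d.O' n m :=
  Submodule.subset_span (Or.inr ⟨u, rfl⟩)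

theorem O'_le (d : VOA V) {n m : ℕ} {W : Submodule ℂ V}
    (h : ∀ r, ∀ u ∈ d.grading r, ∀ v, d.circmn n m u v ∈ W)
    (h' : ∀ u, d.LL u + ((m : ℂ) - n) • u ∈ W) : d.O' n m ≤ W := by
  refine Submodule.span_le.2 ?_
  rintro _ (⟨u, v, rfl⟩ | ⟨u, rfl⟩)
  · rw [SetLike.mem_coe]
    induction u using d.homogeneous_induction with
    | h0 => rw [circmn, bres_eq_wres, map_zero]; exact zero_mem _
    | hadd a b ha hb =>
      rw [circmn, bres_eq_wres] at ha hb ⊢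
      rw [map_add]
      exact add_mem ha hb
    | hm r a ha => exact h r a ha v
  · exact h' u

theorem starmpn_mem_right (d : VOA V) (n p : ℕ) {m : ℕ} (a : V) {x : V} (hx : x ∈ d.O' p m) :
    d.starmpn m p n a x ∈ d.O' n m := by
  rw [starmpn_eq_wres]
  induction a using d.homogeneous_induction with
  | h0 => rw [map_zero]; exact zero_mem _
  | hadd a b ha hb => rw [map_add]; exact add_mem ha hb
  | hm wa a ha =>
    suffices d.O' p m ≤ (d.O' n m).comap (d.wres a (starKer m p n)) from this hx
    refine d.O'_le (fun wb b hb c => ?_) fun u => ?_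
    · rw [Submodule.mem_comap, circmn, bres_eq_wres]
      have hK : X ^ ((m : ℤ) + 1) * Z ^ (-((p : ℤ) + m + 2)) ∈ S (m + 1) (p + 1) :=
        monomial_mem_S _ _ rfl (by omega)
      rw [← Submodule.sub_mem_iff_left _ (Submodule.sum_mem _ fun i _ => ?_)]
      · exact d.wres_starKer_wres_sub_mem ha hb c m n m p hK (by omega) le_rfl le_rfl
      refine Submodule.smul_mem _ _ (finsum_induction (· ∈ d.O' n m) (zero_mem _)
        (fun _ _ => add_mem) fun j => d.wres_mem_O' ?_ _ _)
      exact S_mono (mul_mem_S (X_zpow_mem _)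
        (mul_mem_S hK (twistD_mem_S _ j (T_mem _ p)) rfl le_rfl) rfl le_rfl)
        (by omega) (by omega)
    · rw [Submodule.mem_comap, map_add, map_smul]
      have h1 := d.LL_wres a u (starKer m p n)
      have h2 := d.LL_add_smul_mem n m (d.wres a (starKer m p n) u)
      have h3 := d.wres_mem_O' (X_zpow_mul_euler_T_mem m p n) a u
      rw [euler_starKer, map_add, map_smul] at h1
      rw [h1] at h2
      convert add_mem h2 h3 using 1
      simp only [LinearMap.add_apply, LinearMap.smul_apply]
      module

theorem wres_hres_sub_mem (d : VOA V) {n m : ℕ} (a b c : V) (N k : ℤ) (F : LaurentSeries ℂ)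
    (Q : ℕ → LaurentSeries ℂ) (h : ∀ j, cbinom N j • F - Q j ∈ S (m + 1) (n + 1)) :
    d.wres (d.hres N k a b) F c - ∑ᶠ j : ℕ, d.wres (d.mode a (-k + j) b) (Q j) c ∈ d.O' n m := by
  obtain ⟨M, hM⟩ := d.truncation a b
  have hf (f : ℕ → V) (hf : ∀ j : ℕ, d.mode a (-k + j) b = 0 → f j = 0) :
      (Function.support f).Finite := by
    refine (Set.finite_Iic (M + k).toNat).subset fun j hj => ?_
    rw [Function.mem_support] at hj
    contrapose! hj
    rw [Set.mem_Iic, not_le] at hj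
    exact hf j (hM _ (by omega))
  have h1 : d.wres (d.hres N k a b) F c =
      ∑ᶠ j : ℕ, d.wres (d.mode a (-k + j) b) (cbinom N j • F) c := by
    change (d.wres.flip F).flip c (d.hres N k a b) = _
    rw [hres, map_finsum]
    · refine finsum_congr fun j => ?_
      rw [map_smul, sub_eq_neg_add, map_smul]
      rfl
    · refine hf _ fun j hj => ?_
      rw [sub_eq_neg_add, hj, smul_zero]
  rw [h1, ← finsum_sub_distrib (hf _ fun j hj => by simp [hj]) (hf _ fun j hj => by simp [hj])]
  refine finsum_induction (· ∈ d.O' n m) (zero_mem _) (fun _ _ => add_mem) fun j => ?_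
  rw [← LinearMap.sub_apply, ← map_sub]
  exact d.wres_mem_O' (h j) _ _

theorem bres_of_mem (d : VOA V) {wa : ℤ} {a : V} (ha : a ∈ d.grading wa) (m k : ℤ) (b : V) :
    d.bres m k a b = d.hres (wa + m) k a b := by
  rw [bres_eq_wres, d.wres_of_mem ha, hres_eq_res, ← mul_assoc, ← zpow_add₀ X_ne_zero,
    show wa - 1 + (m + 1) = wa + m by ring]

theorem starmpn_of_mem (d : VOA V) {wa : ℤ} {a : V} (ha : a ∈ d.grading wa) (m p n : ℕ) (b : V) :
    d.starmpn m p n a b = ∑ i ∈ Finset.range (p + 1), cbinom (-((m : ℤ) + n - p + 1)) i •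
      d.hres (wa + m) ((m : ℤ) + n - p + 1 + i) a b := by
  refine Finset.sum_congr rfl fun i _ => ?_
  rw [d.bres_of_mem ha, ← cbinom_neg, neg_add', show (m : ℤ) + n - p + i + 1 = m + n - p + 1 + i by
    ring]

theorem starmpn_mem_left (d : VOA V) {n p : ℕ} (m : ℕ) {x : V} (hx : x ∈ d.O' n p) (c : V) :
    d.starmpn m p n x c ∈ d.O' n m := by
  rw [starmpn_eq_wres]
  suffices d.O' n p ≤ (d.O' n m).comap ((d.wres.flip (starKer m p n)).flip c) from this hx
  refine d.O'_le (fun wa a ha b => ?_) fun u => ?_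
  · change d.wres (d.circmn n p a b) (starKer m p n) c ∈ d.O' n m
    rw [circmn, d.bres_of_mem ha]
    induction b using d.homogeneous_induction with
    | h0 => simp [hres]
    | hadd b b' hb hb' =>
      rw [hres_eq_res] at hb hb' ⊢
      rw [map_add, map_add]
      exact add_mem hb hb'
    | hm wb b hb =>
      have h1 := d.assocRes_eq a b c (-(n + p + 2)) (X ^ (wa + p) * T m p)
        (X ^ (wb - 1) * (X ^ ((n : ℤ) + 1) * starKer m p n))
      rw [d.assocRes_eq_wres ha hb] at h1
      have h2 := d.iterRes_mem_O' (n := n) (m := m) ha b c (r := -(n + p + 2))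
        (mul_mem_S (X_zpow_mem (p + 1)) (T_mem m p) rfl le_rfl) (by omega) (by omega)
        (X ^ (wb - 1) * (X ^ ((n : ℤ) + 1) * starKer m p n))
      have h3 := d.iterRes_mem_O' (n := n) (m := m) hb a c (r := -(n + p + 2))
        (mul_mem_S (X_zpow_mem (n + 1)) (starKer_mem m p n) rfl le_rfl) (by omega) (by omega)
        (X ^ (wa + p) * T m p)
      rw [← mul_assoc, ← zpow_add₀ X_ne_zero, show wa - 1 + (p + 1) = wa + p by ring] at h2
      have h4 := sub_mem h2 (Submodule.smul_mem _ ((-1 : ℂ) ^ (-(n + p + 2) : ℤ)) h3)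
      rw [← h1] at h4
      have h5 (j : ℕ) : X ^ (wa + p + -(n + p + 2) + 1 - wa) * (X ^ ((n : ℤ) + 1) * starKer m p n *
          twistD (wa + p) j (T m p)) = starKer m p n * twistD (wa + p) j (T m p) := by
        rw [mul_assoc, ← mul_assoc, ← zpow_add₀ X_ne_zero,
          show wa + p + -(n + p + 2 : ℤ) + 1 - wa + (n + 1) = 0 by ring, zpow_zero, one_mul]
      simp only [h5] at h4
      refine (Submodule.sub_mem_iff_left _ h4).1 (d.wres_hres_sub_mem a b c _ _ _ _ fun j => ?_)
      have h6 : cbinom (wa + p) j • starKer m p n - starKer m p n * twistD (wa + p) j (T m p) =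
          -(X ^ ((p : ℤ) - n) * (T ((m : ℤ) + n - p + 1) p * twistD (wa + p) j (T m p - 1))) := by
        rw [twistD_sub, twistD_one, mul_sub, mul_sub, mul_smul_comm, mul_smul_comm, mul_one,
          starKer]
        ring
      rw [h6]
      refine neg_mem (X_zpow_mul_mem (α := m + n - p + 1) (mul_mem_S (T_mem _ p)
        (twistD_mem_S _ _ (sub_mem (T_mem_of_le (by omega)) one_mem_S)) (by omega) le_rfl)
        (mul_mem_S (T_mem _ p) (twistD_mem_S _ _
          (T_sub_one_mem_of_le (α := 0) (by omega) le_rfl le_rfl)) rfl (by omega)) le_rfl)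
  · change d.wres (d.LL u + ((p : ℂ) - n) • u) (starKer m p n) c ∈ d.O' n m
    have h := d.wres_mem_O' (X_zpow_mul_euler_T_mem m p n) u c
    rw [map_add, map_smul, LinearMap.add_apply, LinearMap.add_apply, wres_LL_left, euler_starKer,
      map_add, map_smul]
    convert neg_mem h using 1
    simp only [LinearMap.add_apply, LinearMap.smul_apply]
    module

theorem starmpn_assoc_mem (d : VOA V) (m p₁ p₂ n : ℕ) (a b c : V) :
    d.starmpn m p₁ n (d.starmpn p₁ p₂ n a b) c - d.starmpn m p₂ n a (d.starmpn m p₁ p₂ b c) ∈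
      d.O' n m := by
  induction a using d.homogeneous_induction with
  | h0 => simp [starmpn_eq_wres]
  | hadd a a' ha ha' =>
    simp only [starmpn_eq_wres, map_add, LinearMap.add_apply, add_sub_add_comm] at ha ha' ⊢
    exact add_mem ha ha'
  | hm wa a ha =>
  induction b using d.homogeneous_induction with
  | h0 => simp [starmpn_eq_wres]
  | hadd b b' hb hb' =>
    simp only [starmpn_eq_wres, map_add, LinearMap.add_apply, add_sub_add_comm] at hb hb' ⊢
    exact add_mem hb hb'
  | hm wb b hb =>
  have h1 := d.wres_starKer_wres_sub_mem ha hb c m n p₁ p₂ (starKer_mem m p₁ p₂) le_rfl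
    (E := m + 1 + n + p₂) (q := p₁ + p₂) le_rfl (by omega)
  rw [d.starmpn_of_mem ha, starmpn_eq_wres _ m p₁ n, starmpn_eq_wres _ m p₂ n,
    starmpn_eq_wres _ m p₁ p₂]
  rw [map_sum, LinearMap.sum_apply, LinearMap.sum_apply]
  refine (Submodule.add_mem_iff_left _ h1).1 ?_
  rw [sub_add_sub_cancel, ← Finset.sum_sub_distrib]
  refine Submodule.sum_mem _ fun i _ => ?_
  rw [map_smul, LinearMap.smul_apply, LinearMap.smul_apply, ← smul_sub, ← neg_add']
  refine Submodule.smul_mem _ _ (d.wres_hres_sub_mem a b c _ _ _ _ fun j => ?_)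
  set E : ℤ := m + 1 + n + p₂
  set q : ℕ := p₁ + p₂
  have h2 : cbinom (wa + p₁) j • starKer m p₁ n - X ^ ((p₂ : ℤ) - n) * (starKer m p₁ p₂ *
      twistD (wa + p₁) j (T E q)) = X ^ ((p₁ : ℤ) - n) *
        (cbinom (wa + p₁) j • T ((m : ℤ) + n - p₁ + 1) p₁ -
          T ((m : ℤ) + p₂ - p₁ + 1) p₁ * twistD (wa + p₁) j (T E q)) := by
    rw [starKer, starKer, mul_sub, mul_smul_comm, ← mul_assoc, ← mul_assoc,
      ← mul_assoc, ← zpow_add₀ X_ne_zero, show (p₂ : ℤ) - n + (p₁ - p₂) = p₁ - n by ring]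
  rw [h2]
  refine X_zpow_mul_mem (α := m + n - p₁ + 1)
    (α' := min (min (m + n - p₁ + 1) 0) (min (m + p₂ - p₁ + 1) 0))
    (sub_mem (Submodule.smul_mem _ _ (T_mem _ _)) (S_mono (mul_mem_S (T_mem _ _)
      (twistD_mem_S _ _ (T_mem _ _)) rfl le_rfl) (by omega) le_rfl)) ?_ le_rfl
  have h3 : cbinom (wa + p₁) j • T ((m : ℤ) + n - p₁ + 1) p₁ -
      T ((m : ℤ) + p₂ - p₁ + 1) p₁ * twistD (wa + p₁) j (T E q) =
      cbinom (wa + p₁) j • (T ((m : ℤ) + n - p₁ + 1) p₁ - 1) -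
      ((T ((m : ℤ) + p₂ - p₁ + 1) p₁ - 1) * twistD (wa + p₁) j (T E q) +
        twistD (wa + p₁) j (T E q - 1)) := by
    rw [twistD_sub, twistD_one, smul_sub]
    ring
  rw [h3]
  refine sub_mem (Submodule.smul_mem _ _ (T_sub_one_mem_of_le (by omega) (by omega) le_rfl))
    (add_mem (S_mono (mul_mem_S (T_sub_one_mem _ _) (twistD_mem_S _ _ (T_mem _ _)) rfl le_rfl)
      (by omega) (by omega)) (twistD_mem_S _ _
        (T_sub_one_mem_of_le (by omega) (by omega) (by omega))))

end VOA

/-- `O_n(V) = O_{n,n}(V)`, so the natural surjection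
`A_n(V) → A_{n,n}(V)` is an isomorphism. -/
theorem stmt16 (d : VOA V) (n : ℕ) : d.On n = d.Onm n n := by
  refine le_antisymm ?_ ?_
  · rw [d.On_eq]
    exact Submodule.span_mono (Set.subset_union_left.trans Set.subset_union_left)
  · rw [VOA.Onm, d.On_eq]
    refine Submodule.span_le.2 ?_
    rintro _ (((h | h) | ⟨u, a, b, c, p₁, p₂, p₃, rfl⟩) | ⟨p, u, x, v, hx, rfl⟩)
    · exact Submodule.subset_span (Or.inl h)
    · exact Submodule.subset_span (Or.inr h)
    · exact d.starmpn_mem_right n p₃ u (d.starmpn_assoc_mem n p₁ p₂ p₃ a b c)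
    · rw [d.On_eq] at hx
      have h1 := d.starmpn_assoc_mem n p p n u x v
      have h2 := d.starmpn_mem_right n p u (d.starmpn_mem_left n hx v)
      exact (Submodule.sub_mem_iff_left _ h2).1 h1
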